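/- arXiv:1506.07303 — 2 statements merged into one kernel-verified Lean document; each statement's English description precedes it below -/
import Mathlib

section
/- For every ordering ξ of the Pascal graph and every k ≥ 1, the subshift (Σ_k, σ) is topologically weakly mixing, where Σ_k ⊆ 𝒫_k^ℤ is the set of all bi-infinite sequences each of whose finite subblocks occurs as a subblock of some level-k coded basic block B^k_ξ(x,y). -/
/-- Vertex reached after `n` moves: (number of `false` moves, number of `true` moves). -/
def vertexAt (γ : ℕ → Bool) (n : ℕ) : ℕ × ℕ :=
  (((Finset.range n).filter fun i => γ i = false).card,
   ((Finset.range n).filter fun i => γ i = true).card)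

def childOf (v : ℕ × ℕ) (m : Bool) : ℕ × ℕ :=
  if m then (v.1, v.2 + 1) else (v.1 + 1, v.2)

def MoveMin (ξ : ℕ × ℕ → Bool) (v : ℕ × ℕ) (m : Bool) : Prop :=
  (childOf v m).1 = 0 ∨ (childOf v m).2 = 0 ∨ m = !ξ (childOf v m)

def MoveMax (ξ : ℕ × ℕ → Bool) (v : ℕ × ℕ) (m : Bool) : Prop :=
  (childOf v m).1 = 0 ∨ (childOf v m).2 = 0 ∨ m = ξ (childOf v m)

def IsMinEdge (ξ : ℕ × ℕ → Bool) (γ : ℕ → Bool) (i : ℕ) : Prop :=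
  MoveMin ξ (vertexAt γ i) (γ i)

def IsMaxEdge (ξ : ℕ × ℕ → Bool) (γ : ℕ → Bool) (i : ℕ) : Prop :=
  MoveMax ξ (vertexAt γ i) (γ i)

def XMin (ξ : ℕ × ℕ → Bool) : Set (ℕ → Bool) := {γ | ∀ i, IsMinEdge ξ γ i}

def XMax (ξ : ℕ × ℕ → Bool) : Set (ℕ → Bool) := {γ | ∀ i, IsMaxEdge ξ γ i}

def XPrime (ξ : ℕ × ℕ → Bool) : Set (ℕ → Bool) :=
  {γ | ∃ δ ∈ XMin ξ ∪ XMax ξ, ∃ N : ℕ, ∀ n, N ≤ n → γ n = δ n}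

/-- The all-ξ-minimal finite path (list of moves) from the root to a vertex. -/
def minPath (ξ : ℕ × ℕ → Bool) : ℕ × ℕ → List Bool
  | (0, 0) => []
  | (x + 1, 0) => minPath ξ (x, 0) ++ [false]
  | (0, y + 1) => minPath ξ (0, y) ++ [true]
  | (x + 1, y + 1) =>
      if ξ (x + 1, y + 1) then minPath ξ (x, y + 1) ++ [false]
      else minPath ξ (x + 1, y) ++ [true]
  termination_by p => p.1 + p.2

/-- The all-ξ-maximal finite path (list of moves) from the root to a vertex. -/
def maxPath (ξ : ℕ × ℕ → Bool) : ℕ × ℕ → List Bool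
  | (0, 0) => []
  | (x + 1, 0) => maxPath ξ (x, 0) ++ [false]
  | (0, y + 1) => maxPath ξ (0, y) ++ [true]
  | (x + 1, y + 1) =>
      if ξ (x + 1, y + 1) then maxPath ξ (x + 1, y) ++ [true]
      else maxPath ξ (x, y + 1) ++ [false]
  termination_by p => p.1 + p.2

open Classical in
/-- The adic (Vershik) transformation determined by ξ (identity where undefined). -/
noncomputable def adicT (ξ : ℕ × ℕ → Bool) (γ : ℕ → Bool) : ℕ → Bool :=
  if h : ∃ i, ¬ IsMaxEdge ξ γ i then
    let i0 := Nat.find h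
    let v := vertexAt γ (i0 + 1)
    let src : ℕ × ℕ := if ξ v then (v.1, v.2 - 1) else (v.1 - 1, v.2)
    fun n =>
      if n < i0 then (minPath ξ src).getD n false
      else if n = i0 then ξ v
      else γ n
  else γ

open Classical in
/-- The inverse adic transformation determined by ξ (identity where undefined). -/
noncomputable def adicTInv (ξ : ℕ × ℕ → Bool) (γ : ℕ → Bool) : ℕ → Bool :=
  if h : ∃ i, ¬ IsMinEdge ξ γ i then
    let i0 := Nat.find h
    let v := vertexAt γ (i0 + 1)
    let src : ℕ × ℕ := if ξ v then (v.1 - 1, v.2) else (v.1, v.2 - 1)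
    fun n =>
      if n < i0 then (maxPath ξ src).getD n false
      else if n = i0 then !ξ v
      else γ n
  else γ

/-- ℤ-iterates of the adic transformation. -/
noncomputable def adicIter (ξ : ℕ × ℕ → Bool) : ℤ → (ℕ → Bool) → (ℕ → Bool)
  | Int.ofNat n, γ => (adicT ξ)^[n] γ
  | Int.negSucc n, γ => (adicTInv ξ)^[n + 1] γ

/-- The k-coding of the orbit of γ: symbols are the initial segments of length k. -/
noncomputable def omegaCode (ξ : ℕ × ℕ → Bool) (k : ℕ) (γ : ℕ → Bool) : ℤ → List Bool :=
  fun t => (List.range k).map (adicIter ξ t γ)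

/-- Ordered list of all initial segments from the root to (x,y), in increasing ξ-order. -/
def segList (ξ : ℕ × ℕ → Bool) : ℕ × ℕ → List (List Bool)
  | (0, 0) => [[]]
  | (x + 1, 0) => (segList ξ (x, 0)).map (· ++ [false])
  | (0, y + 1) => (segList ξ (0, y)).map (· ++ [true])
  | (x + 1, y + 1) =>
      if ξ (x + 1, y + 1) then
        (segList ξ (x, y + 1)).map (· ++ [false]) ++ (segList ξ (x + 1, y)).map (· ++ [true])
      else
        (segList ξ (x + 1, y)).map (· ++ [true]) ++ (segList ξ (x, y + 1)).map (· ++ [false])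
  termination_by p => p.1 + p.2

/-- Level-k coded basic block at a vertex (x,y) with x+y ≥ k, a word over the
alphabet of initial segments of length k. -/
def codedBlock (ξ : ℕ × ℕ → Bool) (k : ℕ) : ℕ × ℕ → List (List Bool)
  | (0, 0) => segList ξ (0, 0)
  | (x + 1, 0) => if x + 1 ≤ k then segList ξ (x + 1, 0) else [List.replicate k false]
  | (0, y + 1) => if y + 1 ≤ k then segList ξ (0, y + 1) else [List.replicate k true]
  | (x + 1, y + 1) =>
      if x + 1 + (y + 1) ≤ k then segList ξ (x + 1, y + 1)
      else if ξ (x + 1, y + 1) then codedBlock ξ k (x, y + 1) ++ codedBlock ξ k (x + 1, y)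
      else codedBlock ξ k (x + 1, y) ++ codedBlock ξ k (x, y + 1)
  termination_by p => p.1 + p.2

/-- Basic block over the alphabet {a,b}, with a = `false` and b = `true`. -/
def basicBlock (ξ : ℕ × ℕ → Bool) : ℕ × ℕ → List Bool
  | (0, 0) => []
  | (_ + 1, 0) => [false]
  | (0, _ + 1) => [true]
  | (x + 1, y + 1) =>
      if ξ (x + 1, y + 1) then basicBlock ξ (x, y + 1) ++ basicBlock ξ (x + 1, y)
      else basicBlock ξ (x + 1, y) ++ basicBlock ξ (x, y + 1)
  termination_by p => p.1 + p.2

/-- The finite word ω_s ω_{s+1} ... ω_{t-1}. -/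
def wordAt (ω : ℤ → List Bool) (s t : ℤ) : List (List Bool) :=
  (List.range (t - s).toNat).map fun u => ω (s + u)

/-- A ξ-consistent factoring scheme for ω ∈ 𝒫_k^ℤ: `cuts j` is the set of starting
positions of the blocks of the level-(k+j) factorization, and `vert j s` is the
vertex whose coded basic block is the block starting at the cut `s`. -/
def IsConsistentScheme (ξ : ℕ × ℕ → Bool) (k : ℕ) (ω : ℤ → List Bool)
    (cuts : ℕ → Set ℤ) (vert : ℕ → ℤ → ℕ × ℕ) : Prop :=
  (∀ j : ℕ, ∀ M : ℤ, ∃ s ∈ cuts j, s < M) ∧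
  (∀ j : ℕ, ∀ M : ℤ, ∃ t ∈ cuts j, M < t) ∧
  (∀ j : ℕ, ∀ s ∈ cuts j, ∀ t ∈ cuts j, s < t → (∀ u ∈ cuts j, ¬(s < u ∧ u < t)) →
      (vert j s).1 + (vert j s).2 = k + j ∧
      wordAt ω s t = codedBlock ξ k (vert j s)) ∧
  (∀ j : ℕ, cuts (j + 1) ⊆ cuts j) ∧
  (∀ j : ℕ, ∀ s ∈ cuts (j + 1), ∀ t ∈ cuts (j + 1), s < t →
      (∀ u ∈ cuts (j + 1), ¬(s < u ∧ u < t)) →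
      ∀ x y : ℕ, vert (j + 1) s = (x + 1, y + 1) →
        ∃ m ∈ cuts j, s < m ∧ m < t ∧ (∀ u ∈ cuts j, s < u → u < t → u = m) ∧
          (if ξ (x + 1, y + 1)
            then vert j s = (x, y + 1) ∧ vert j m = (x + 1, y)
            else vert j s = (x + 1, y) ∧ vert j m = (x, y + 1)))

/-- The natural factoring scheme of the k-coding of γ: a level-(k+j) block begins at
coordinate t exactly when T^t γ begins with an all-ξ-minimal path to its level-(k+j) vertex. -/
noncomputable def natCuts (ξ : ℕ × ℕ → Bool) (k : ℕ) (γ : ℕ → Bool) : ℕ → Set ℤ :=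
  fun j => {t | ∀ i < k + j, IsMinEdge ξ (adicIter ξ t γ) i}

noncomputable def natVert (ξ : ℕ × ℕ → Bool) (k : ℕ) (γ : ℕ → Bool) : ℕ → ℤ → ℕ × ℕ :=
  fun j t => vertexAt (adicIter ξ t γ) (k + j)

open Classical in
/-- The return time r_n of the Kink Lemma, where `g` is the move of γ leaving (i,j). -/
noncomputable def kinkReturn (ξ : ℕ × ℕ → Bool) (i j : ℕ) (g : Bool) : ℕ :=
  let n := i + j
  if MoveMax ξ (i, j) g ∧ MoveMin ξ (i, j) (!g) then n.choose j
  else if (MoveMin ξ (i, j) g ∧ MoveMin ξ (i, j) (!g) ∧ g = true) ∨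
          (MoveMax ξ (i, j) g ∧ MoveMax ξ (i, j) (!g) ∧ g = false) then (n + 1).choose (j + 1)
  else if (MoveMin ξ (i, j) g ∧ MoveMin ξ (i, j) (!g) ∧ g = false) ∨
          (MoveMax ξ (i, j) g ∧ MoveMax ξ (i, j) (!g) ∧ g = true) then (n + 1).choose j
  else (n + 1).choose j + n.choose (j + 1)

/-- Convert a length-k list of moves to a function `Fin k → Bool`. -/
def segFn (k : ℕ) (w : List Bool) : Fin k → Bool := fun idx => w.getD idx false

/-- The subshift Σ_k of the k-codings: sequences all of whose finite subblocks occur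
in some level-k coded basic block. -/
def SigmaK (ξ : ℕ × ℕ → Bool) (k : ℕ) : Set (ℤ → (Fin k → Bool)) :=
  {ω | ∀ (s : ℤ) (l : ℕ), ∃ p : ℕ × ℕ,
    ((List.range l).map fun u => ω (s + u)) <:+: (codedBlock ξ k p).map (segFn k)}

/-- The subshift Σ_ξ ⊆ {a,b}^ℤ of sequences all of whose finite subblocks occur in
some basic block B_ξ(x,y). -/
def SigmaXi (ξ : ℕ × ℕ → Bool) : Set (ℤ → Bool) :=
  {ω | ∀ (s : ℤ) (l : ℕ), ∃ p : ℕ × ℕ,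
    ((List.range l).map fun u => ω (s + u)) <:+: basicBlock ξ p}

/-- The big subshift Σ: sequences all of whose finite subblocks occur in some basic
block B_ξ(x,y) for some ordering ξ. -/
def BigShift : Set (ℤ → Bool) :=
  {ω | ∀ (s : ℤ) (l : ℕ), ∃ (ξ : ℕ × ℕ → Bool) (p : ℕ × ℕ),
    ((List.range l).map fun u => ω (s + u)) <:+: basicBlock ξ p}

section

open Filter Topology

/-- An ultrafilter limit along a fixed free ultrafilter on `ℕ`. -/
noncomputable def ulim (f : ℕ → ℝ) : ℝ := limUnder (hyperfilter ℕ : Filter ℕ) f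

theorem tendsto_ulim {f : ℕ → ℝ} {C : ℝ} (h : ∀ n, |f n| ≤ C) :
    Tendsto f (hyperfilter ℕ : Filter ℕ) (𝓝 (ulim f)) := by
  apply tendsto_nhds_limUnder
  obtain ⟨x, -, hx⟩ := (isCompact_Icc (a := -C) (b := C)).ultrafilter_le_nhds
    ((hyperfilter ℕ).map f) (by
      simp only [Ultrafilter.coe_map, le_principal_iff, mem_map]
      exact Filter.univ_mem' fun n => abs_le.mp (h n))
  exact ⟨x, hx⟩

theorem eventually_hyperfilter {P : ℕ → Prop} (h : ∀ᶠ n in atTop, P n) :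
    ∀ᶠ n in (hyperfilter ℕ : Filter ℕ), P n :=
  Nat.hyperfilter_le_atTop h

attribute [local instance] Ultrafilter.add Ultrafilter.addSemigroup in
theorem exists_idempotent_ultrafilter_nat : ∃ U : Ultrafilter ℕ,
    (∀ P : ℕ → Prop, (∀ᶠ n in U, P n) → ∀ᶠ m in U, ∀ᶠ n in U, P (m + n)) ∧
    ∀ N : ℕ, ∀ᶠ n in (U : Filter ℕ), N ≤ n := by
  obtain ⟨V, hV⟩ := @exists_idempotent_of_compact_t2_of_continuous_add_left
    (Ultrafilter ℕ+) _ _ _ _ _ Ultrafilter.continuous_add_left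
  have key : ∀ P : ℕ → Prop, (∀ᶠ n : ℕ+ in V, P n) →
      ∀ᶠ m : ℕ+ in V, ∀ᶠ n : ℕ+ in V, P (m + n) := by
    intro P h
    rw [← hV, Ultrafilter.eventually_add] at h
    simpa using h
  refine ⟨V.map (fun n : ℕ+ => (n : ℕ)), fun P h => key P h, fun N => ?_⟩
  change ∀ᶠ n : ℕ+ in V, N ≤ (n : ℕ)
  induction N with
  | zero => simp
  | succ N ih =>
    have h2 := key _ ih
    have : ∀ᶠ n : ℕ+ in V, N ≤ (n : ℕ) ∧ ∀ᶠ m : ℕ+ in V, N ≤ (m : ℕ) := by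
      filter_upwards [ih] with n hn using ⟨hn, ih⟩
    have h3 : ∀ᶠ n : ℕ+ in V + V, N + 1 ≤ (n : ℕ) := by
      rw [Ultrafilter.eventually_add]
      filter_upwards [ih] with m hm
      filter_upwards with n
      have := n.pos
      push_cast
      omega
    rwa [hV] at h3

theorem choose_recurrence {ρ : ℤ → ℝ} (h0 : ρ 0 = 0) (hneg : ∀ n, ρ (-n) = ρ n)
    (hadd : ∀ m n, ρ (m + n) ≤ ρ m + ρ n)
    (htb : ∀ ε > 0, ∃ F : Finset ℤ, ∀ n, ∃ f ∈ F, ρ (n - f) ≤ ε)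
    (U : Ultrafilter ℕ)
    (hU : ∀ P : ℕ → Prop, (∀ᶠ n in U, P n) → ∀ᶠ m in U, ∀ᶠ n in U, P (m + n))
    (j m : ℕ) (ε : ℝ) (hε : 0 < ε) :
    ∀ᶠ n in U, ρ (((n + m).choose j : ℤ) - (m.choose j : ℤ)) ≤ ε := by
  have hsub : ∀ m n, ρ (m - n) ≤ ρ m + ρ n := fun m n => by
    simpa [sub_eq_add_neg, hneg] using hadd m (-n)
  induction j generalizing m ε with
  | zero => simp [h0, hε.le]
  | succ j ih =>
    have cross : ∀ (m : ℕ) (ε : ℝ), 0 < ε → ∀ᶠ n : ℕ in U,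
        ρ (((n + m).choose (j + 1) : ℤ) - (n.choose (j + 1) : ℤ) - (m.choose (j + 1) : ℤ)) ≤ ε := by
      intro m
      induction m with
      | zero => intro ε hε; simp [h0, hε.le]
      | succ m ihm =>
        intro ε hε
        filter_upwards [ihm (ε / 2) (by positivity), ih m (ε / 2) (by positivity)] with n h1 h2
        have e : (((n + (m + 1)).choose (j + 1) : ℕ) : ℤ) - (n.choose (j + 1) : ℤ)
            - ((m + 1).choose (j + 1) : ℤ) =
            (((n + m).choose (j + 1) : ℤ) - (n.choose (j + 1) : ℤ) - (m.choose (j + 1) : ℤ)) +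
            (((n + m).choose j : ℤ) - (m.choose j : ℤ)) := by
          rw [← add_assoc, Nat.choose_succ_succ, Nat.choose_succ_succ]
          push_cast
          ring
        rw [e]
        linarith [hadd (((n + m).choose (j + 1) : ℤ) - (n.choose (j + 1) : ℤ)
          - (m.choose (j + 1) : ℤ)) (((n + m).choose j : ℤ) - (m.choose j : ℤ))]
    have small : ∀ ε > 0, ∀ᶠ n : ℕ in U, ρ (n.choose (j + 1) : ℤ) ≤ ε := by
      intro ε hε
      obtain ⟨F, hF⟩ := htb (ε / 5) (by positivity)
      have h1 : ∀ᶠ n : ℕ in U, ∃ f ∈ (F : Set ℤ), ρ ((n.choose (j + 1) : ℤ) - f) ≤ ε / 5 :=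
        Eventually.of_forall fun n => hF _
      rw [Ultrafilter.eventually_exists_mem_iff F.finite_toSet] at h1
      obtain ⟨f, -, hf⟩ := h1
      obtain ⟨m, hm1, hm2⟩ := (hf.and (hU _ hf)).exists
      obtain ⟨n, hn1, hn2, hn3⟩ := (hm2.and (hf.and (cross m (ε / 5) (by positivity)))).exists
      have hρf : ρ f ≤ 4 * (ε / 5) := by
        rw [add_comm m n] at hn1
        have e : f = ((((n + m).choose (j + 1) : ℤ) - f) - ((n.choose (j + 1) : ℤ) - f))
          - (((((n + m).choose (j + 1) : ℤ) - (n.choose (j + 1) : ℤ) - (m.choose (j + 1) : ℤ)))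
          + ((m.choose (j + 1) : ℤ) - f)) := by ring
        have a1 := hsub ((((n + m).choose (j + 1) : ℤ) - f) - ((n.choose (j + 1) : ℤ) - f))
          (((((n + m).choose (j + 1) : ℤ) - (n.choose (j + 1) : ℤ) - (m.choose (j + 1) : ℤ)))
          + ((m.choose (j + 1) : ℤ) - f))
        have a2 := hsub (((n + m).choose (j + 1) : ℤ) - f) ((n.choose (j + 1) : ℤ) - f)
        have a3 := hadd (((n + m).choose (j + 1) : ℤ) - (n.choose (j + 1) : ℤ)
          - (m.choose (j + 1) : ℤ)) ((m.choose (j + 1) : ℤ) - f)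
        rw [← e] at a1
        linarith
      filter_upwards [hf] with n hn
      have := hadd ((n.choose (j + 1) : ℤ) - f) f
      rw [sub_add_cancel] at this
      linarith
    filter_upwards [cross m (ε / 2) (by positivity), small (ε / 2) (by positivity)] with n h1 h2
    have := hadd (((n + m).choose (j + 1) : ℤ) - (n.choose (j + 1) : ℤ) - (m.choose (j + 1) : ℤ))
      (n.choose (j + 1) : ℤ)
    rw [sub_right_comm, sub_add_cancel] at this
    rw [sub_right_comm] at h1
    linarith

/-- The number of paths from the root to a vertex, i.e. the length of its basic block. -/
def blockLen (v : ℕ × ℕ) : ℕ := (v.1 + v.2).choose v.2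

theorem blockLen_succ (x y : ℕ) :
    blockLen (x + 1, y + 1) = blockLen (x, y + 1) + blockLen (x + 1, y) := by
  simp only [blockLen]
  rw [show x + 1 + (y + 1) = (x + 1 + y) + 1 by ring, Nat.choose_succ_succ,
    show x + (y + 1) = x + 1 + y by ring, add_comm]

theorem blockLen_pos (v : ℕ × ℕ) : 0 < blockLen v := Nat.choose_pos (Nat.le_add_left _ _)

/-- `Off ξ q Q t`: some path from `q` to `Q` exhibits the block at `q` as a subblock of the
block at `Q` starting at position `t`. -/
inductive Off (ξ : ℕ × ℕ → Bool) (q : ℕ × ℕ) : ℕ × ℕ → ℕ → Prop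
  | refl : Off ξ q q 0
  | right {x y t : ℕ} : Off ξ q (x, y + 1) t →
      Off ξ q (x + 1, y + 1) (t + if ξ (x + 1, y + 1) then 0 else blockLen (x + 1, y))
  | up {x y t : ℕ} : Off ξ q (x + 1, y) t →
      Off ξ q (x + 1, y + 1) (t + if ξ (x + 1, y + 1) then blockLen (x, y + 1) else 0)

namespace Off

variable {ξ : ℕ × ℕ → Bool} {q q' Q : ℕ × ℕ} {s t : ℕ}

theorem trans (h : Off ξ q q' s) (h' : Off ξ q' Q t) : Off ξ q Q (s + t) := by
  induction h' with
  | refl => exact h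
  | right _ ih => rw [← add_assoc]; exact ih.right
  | up _ ih => rw [← add_assoc]; exact ih.up

theorem le (h : Off ξ q Q t) : q.1 ≤ Q.1 ∧ q.2 ≤ Q.2 := by
  induction h with
  | refl => simp
  | right _ ih => simp only at ih ⊢; omega
  | up _ ih => simp only at ih ⊢; omega

theorem add_blockLen_le (h : Off ξ q Q t) : t + blockLen q ≤ blockLen Q := by
  induction h with
  | refl => simp
  | right _ ih => rw [blockLen_succ]; split <;> omega
  | up _ ih => rw [blockLen_succ]; split <;> omega

theorem exists_of_le (hx : 1 ≤ q.1) (hy : 1 ≤ q.2) (h1 : q.1 ≤ Q.1) (h2 : q.2 ≤ Q.2) :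
    ∃ t, Off ξ q Q t := by
  obtain ⟨x, y⟩ := q
  obtain ⟨X, Y⟩ := Q
  simp only at hx hy h1 h2
  induction X, h1 using Nat.le_induction with
  | base =>
    induction Y, h2 using Nat.le_induction with
    | base => exact ⟨0, .refl⟩
    | succ Y _ ih =>
      obtain ⟨t, ht⟩ := ih
      obtain ⟨x, rfl⟩ := Nat.exists_eq_add_of_le' hx
      exact ⟨_, ht.up⟩
  | succ X _ ih =>
    obtain ⟨t, ht⟩ := ih
    obtain ⟨Y, rfl⟩ := Nat.exists_eq_add_of_le' (hy.trans h2)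
    exact ⟨_, ht.right⟩

/-- Every interior block occurs strictly inside the block two diagonal steps further. -/
theorem exists_strictly_inside (x y : ℕ) :
    ∃ t, Off ξ (x + 1, y + 1) (x + 1 + 2, y + 1 + 2) t ∧ 1 ≤ t ∧
      t + blockLen (x + 1, y + 1) + 1 ≤ blockLen (x + 1 + 2, y + 1 + 2) := by
  have first : ∀ x y, ∃ t, Off ξ (x + 1, y + 1) (x + 1 + 1, y + 1 + 1) t ∧
      t + blockLen (x + 1, y + 1) + 1 ≤ blockLen (x + 1 + 1, y + 1 + 1) := by
    intro x y
    have p1 := blockLen_pos (x + 1, y + 1 + 1)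
    have p2 := blockLen_pos (x + 1 + 1, y + 1)
    have e := blockLen_succ (x + 1) (y + 1)
    have hu := (Off.refl (ξ := ξ) (q := (x + 1, y + 1))).up
    have hr := (Off.refl (ξ := ξ) (q := (x + 1, y + 1))).right
    have lu := hu.add_blockLen_le
    have lr := hr.add_blockLen_le
    rcases hξ : ξ (x + 1 + 1, y + 1 + 1) with _ | _
    · refine ⟨_, hr.up, ?_⟩
      rw [hξ]
      simp only [Bool.false_eq_true, if_false]
      omega
    · refine ⟨_, hu.right, ?_⟩
      rw [hξ]
      simp only [if_true]
      omega
  have second : ∀ x y, ∃ t, Off ξ (x + 1, y + 1) (x + 1 + 1, y + 1 + 1) t ∧ 1 ≤ t := by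
    intro x y
    have p1 := blockLen_pos (x + 1, y + 1 + 1)
    have p2 := blockLen_pos (x + 1 + 1, y + 1)
    rcases hξ : ξ (x + 1 + 1, y + 1 + 1) with _ | _
    · refine ⟨_, (Off.refl (ξ := ξ) (q := (x + 1, y + 1))).up.right, ?_⟩
      rw [hξ]
      simp only [Bool.false_eq_true, if_false]
      omega
    · refine ⟨_, (Off.refl (ξ := ξ) (q := (x + 1, y + 1))).right.up, ?_⟩
      rw [hξ]
      simp only [if_true]
      omega
  obtain ⟨s, hs, hs'⟩ := first x y
  obtain ⟨t, ht, ht'⟩ := second (x + 1) (y + 1)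
  have := ht.add_blockLen_le
  exact ⟨s + t, hs.trans ht, by omega, by
    simp only [add_assoc, Nat.reduceAdd] at *; omega⟩

end Off

/-- `r` is a difference of two positions of the block at `q` in a common block. -/
def IsReturn (ξ : ℕ × ℕ → Bool) (q : ℕ × ℕ) (r : ℤ) : Prop :=
  ∃ Q s t, Off ξ q Q s ∧ Off ξ q Q t ∧ r = (s : ℤ) - t

namespace IsReturn

variable {ξ : ℕ × ℕ → Bool} {q q' : ℕ × ℕ} {r : ℤ}

theorem zero (ξ : ℕ × ℕ → Bool) (q : ℕ × ℕ) : IsReturn ξ q 0 :=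
  ⟨q, 0, 0, .refl, .refl, by simp⟩

theorem neg (h : IsReturn ξ q r) : IsReturn ξ q (-r) := by
  obtain ⟨Q, s, t, hs, ht, rfl⟩ := h
  exact ⟨Q, t, s, ht, hs, by ring⟩

theorem of_off {w : ℕ} (hw : Off ξ q q' w) (h : IsReturn ξ q' r) : IsReturn ξ q r := by
  obtain ⟨Q, s, t, hs, ht, rfl⟩ := h
  exact ⟨Q, w + s, w + t, hw.trans hs, hw.trans ht, by push_cast; ring⟩

end IsReturn

/-- The return times around a single box of the Pascal graph. -/
theorem exists_return_box (ξ : ℕ × ℕ → Bool) (x y : ℕ) :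
    ∃ r, IsReturn ξ (x + 1, y + 1) r ∧
      (r = ((x + 1 + (y + 1)).choose (y + 1) : ℤ) ∨
       r = ((x + 1 + (y + 2)).choose (y + 1) : ℤ) ∨
       r = ((x + 1 + (y + 2)).choose (y + 2) : ℤ) ∨
       r = ((x + 1 + (y + 2)).choose (y + 2) : ℤ) + ((x + 1 + (y + 1)).choose y : ℤ)) := by
  have h1 := (Off.refl (ξ := ξ) (q := (x + 1, y + 1))).right.up
  have h2 := (Off.refl (ξ := ξ) (q := (x + 1, y + 1))).up.right
  have e1 : blockLen (x, y + 1 + 1) = (x + 1 + (y + 1)).choose (y + 2) := by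
    simp only [blockLen]; congr 1; ring
  have e2 : blockLen (x + 1 + 1, y) = (x + 1 + (y + 1)).choose y := by
    simp only [blockLen]; congr 1; ring
  have e3 : blockLen (x + 1, y + 1 + 1) = (x + 1 + (y + 1)).choose (y + 1)
      + (x + 1 + (y + 1)).choose (y + 2) := by
    simp only [blockLen]; rw [← Nat.choose_succ_succ]; congr 1
  have e4 : blockLen (x + 1 + 1, y + 1) = (x + 1 + (y + 1)).choose y
      + (x + 1 + (y + 1)).choose (y + 1) := by
    simp only [blockLen]; rw [← Nat.choose_succ_succ]; congr 1; omega
  have e5 : (x + 1 + (y + 2)).choose (y + 1) = (x + 1 + (y + 1)).choose y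
      + (x + 1 + (y + 1)).choose (y + 1) := by
    rw [← Nat.choose_succ_succ]; congr 1
  have e6 : (x + 1 + (y + 2)).choose (y + 2) = (x + 1 + (y + 1)).choose (y + 1)
      + (x + 1 + (y + 1)).choose (y + 2) := by
    rw [← Nat.choose_succ_succ]; congr 1
  have hr : IsReturn ξ (x + 1, y + 1) _ := ⟨_, _, _, h1, h2, rfl⟩
  rw [e1, e2, e3, e4] at hr
  rw [e5, e6]
  generalize (x + 1 + (y + 1)).choose y = a at *
  generalize (x + 1 + (y + 1)).choose (y + 1) = b at *
  generalize (x + 1 + (y + 1)).choose (y + 2) = c at *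
  have hr' := hr.neg
  rcases h1 : ξ (x + 1 + 1, y + 1) with _ | _ <;> rcases h2 : ξ (x + 1, y + 1 + 1) with _ | _ <;>
    rcases h3 : ξ (x + 1 + 1, y + 1 + 1) with _ | _ <;>
    simp only [h1, h2, h3, Bool.false_eq_true, if_true, if_false, zero_add, add_zero] at hr hr' <;>
    first
    | (refine ⟨_, hr, ?_⟩; push_cast; omega)
    | (refine ⟨_, hr', ?_⟩; push_cast; omega)

theorem blockLen_add_le (x y a b : ℕ) (h1 : y + b ≤ 3 * (x + 1)) (h2 : x ≤ 3 * (y + 1)) :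
    blockLen (x + a, y + b) ≤ 4 ^ (a + b) * blockLen (x, y) := by
  have hx : ∀ x y, y ≤ 3 * (x + 1) → blockLen (x + 1, y) ≤ 4 * blockLen (x, y) := by
    intro x y h
    have e := Nat.add_one_mul_choose_eq (x + y) x
    rw [Nat.choose_symm_add, show x + y + 1 = (x + 1) + y by ring, Nat.choose_symm_add] at e
    simp only [blockLen]
    nlinarith
  have hy : ∀ x y, x ≤ 3 * (y + 1) → blockLen (x, y + 1) ≤ 4 * blockLen (x, y) := by
    intro x y h
    have e := Nat.add_one_mul_choose_eq (x + y) y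
    simp only [blockLen, ← add_assoc]
    nlinarith
  induction a with
  | zero =>
    induction b with
    | zero => simp
    | succ b ih =>
      calc blockLen (x + 0, y + b + 1) ≤ 4 * blockLen (x + 0, y + b) := hy _ _ (by omega)
        _ ≤ 4 * (4 ^ (0 + b) * blockLen (x, y)) := by gcongr; exact ih (by omega)
        _ = _ := by ring
  | succ a ih =>
    calc blockLen (x + a + 1, y + b) ≤ 4 * blockLen (x + a, y + b) := hx _ _ (by omega)
      _ ≤ 4 * (4 ^ (a + b) * blockLen (x, y)) := by gcongr
      _ = _ := by ring

open Classical in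
/-- All positions at which the block at `q` is exhibited in the block at `Q`. -/
noncomputable def offsets (ξ : ℕ × ℕ → Bool) (q Q : ℕ × ℕ) : Finset ℕ :=
  (Finset.range (blockLen Q)).filter (Off ξ q Q)

theorem mem_offsets {ξ : ℕ × ℕ → Bool} {q Q : ℕ × ℕ} {t : ℕ} :
    t ∈ offsets ξ q Q ↔ Off ξ q Q t := by
  simp only [offsets, Finset.mem_filter, Finset.mem_range, and_iff_right_iff_imp]
  intro h
  have := h.add_blockLen_le
  have := blockLen_pos q
  omega

theorem lt_of_mem_offsets {ξ : ℕ × ℕ → Bool} {q Q : ℕ × ℕ} {t : ℕ} (h : t ∈ offsets ξ q Q) :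
    t < blockLen Q := by
  simp only [offsets, Finset.mem_filter, Finset.mem_range] at h
  exact h.1

theorem blockLen_le_card_offsets (ξ : ℕ × ℕ → Bool) (x y a b : ℕ) :
    blockLen (a, b) ≤ (offsets ξ (x + 1, y + 1) (x + 1 + a, y + 1 + b)).card := by
  have pos : ∀ a b, 1 ≤ (offsets ξ (x + 1, y + 1) (x + 1 + a, y + 1 + b)).card := by
    intro a b
    obtain ⟨t, ht⟩ := Off.exists_of_le (ξ := ξ) (q := (x + 1, y + 1))
      (Q := (x + 1 + a, y + 1 + b)) (by simp) (by simp) (by simp) (by simp)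
    exact Finset.card_pos.mpr ⟨t, mem_offsets.mpr ht⟩
  induction a generalizing b with
  | zero => simpa [blockLen] using pos 0 b
  | succ a iha =>
    induction b with
    | zero => simpa [blockLen] using pos (a + 1) 0
    | succ b ihb =>
      have h1 := iha (b + 1)
      have h2 := ihb
      set q := (x + 1, y + 1)
      set c := if ξ (x + 1 + a + 1, y + 1 + b + 1) then 0 else blockLen (x + 1 + a + 1, y + 1 + b)
        with hc
      set d := if ξ (x + 1 + a + 1, y + 1 + b + 1) then blockLen (x + 1 + a, y + 1 + b + 1) else 0
        with hd
      set A := offsets ξ q (x + 1 + a, y + 1 + b + 1)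
      set B := offsets ξ q (x + 1 + a + 1, y + 1 + b)
      have hdisj : Disjoint (A.image (· + c)) (B.image (· + d)) := by
        rw [Finset.disjoint_left]
        intro n hn hn'
        obtain ⟨s, hs, rfl⟩ := Finset.mem_image.mp hn
        obtain ⟨t, ht, hst⟩ := Finset.mem_image.mp hn'
        have := lt_of_mem_offsets hs
        have := lt_of_mem_offsets ht
        simp only [hc, hd] at hst
        split_ifs at hst <;> omega
      have hsub : A.image (· + c) ∪ B.image (· + d) ⊆
          offsets ξ q (x + 1 + (a + 1), y + 1 + (b + 1)) := by
        intro n hn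
        rw [mem_offsets]
        rcases Finset.mem_union.mp hn with hn | hn
        · obtain ⟨s, hs, rfl⟩ := Finset.mem_image.mp hn
          exact (mem_offsets.mp hs).right
        · obtain ⟨s, hs, rfl⟩ := Finset.mem_image.mp hn
          exact (mem_offsets.mp hs).up
      have h3 := Finset.card_le_card hsub
      rw [Finset.card_union_of_disjoint hdisj,
        Finset.card_image_of_injective _ (add_left_injective c),
        Finset.card_image_of_injective _ (add_left_injective d)] at h3
      rw [blockLen_succ]
      exact (add_le_add h1 h2).trans h3

theorem lt_blockLen_diag (N : ℕ) : N < blockLen (N, N) := by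
  have h := Nat.le_of_dvd (Nat.centralBinom_pos N) (Nat.succ_dvd_centralBinom N)
  rw [Nat.centralBinom_eq_two_mul_choose, two_mul] at h
  exact h

theorem tendsto_blockLen_diag : Tendsto (fun N => blockLen (N, N)) atTop atTop :=
  tendsto_atTop_mono (fun N => (lt_blockLen_diag N).le) tendsto_id

/-- Every interior block occurs with positive frequency in the diagonal blocks. -/
theorem exists_pos_frequency (ξ : ℕ × ℕ → Bool) {q : ℕ × ℕ} (hx : 1 ≤ q.1) (hy : 1 ≤ q.2) :
    ∃ κ : ℝ, 0 < κ ∧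
      ∀ᶠ N in atTop, κ * blockLen (N, N) ≤ ((offsets ξ q (N, N)).card : ℝ) := by
  obtain ⟨x', y'⟩ := q
  obtain ⟨x, rfl⟩ := Nat.exists_eq_add_of_le' hx
  obtain ⟨y, rfl⟩ := Nat.exists_eq_add_of_le' hy
  refine ⟨((4 : ℝ) ^ (x + 1 + (y + 1)))⁻¹, by positivity, ?_⟩
  filter_upwards [eventually_ge_atTop (2 * (x + y + 2))] with N hN
  obtain ⟨a, ha⟩ := Nat.exists_eq_add_of_le (show x + 1 ≤ N by omega)
  obtain ⟨b, hb⟩ := Nat.exists_eq_add_of_le (show y + 1 ≤ N by omega)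
  have h1 := blockLen_add_le a b (x + 1) (y + 1) (by omega) (by omega)
  have h2 := blockLen_le_card_offsets ξ x y a b
  rw [show a + (x + 1) = N by omega, show b + (y + 1) = N by omega] at h1
  rw [← ha, ← hb] at h2
  rw [inv_mul_le_iff₀ (by positivity)]
  exact_mod_cast h1.trans (Nat.mul_le_mul_left _ h2)

/-- Return times of an interior block are syndetic. -/
theorem exists_finset_return (ξ : ℕ × ℕ → Bool) {q : ℕ × ℕ} (hx : 1 ≤ q.1) (hy : 1 ≤ q.2) :
    ∃ F : Finset ℤ, ∀ n, ∃ f ∈ F, IsReturn ξ q (n - f) := by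
  obtain ⟨κ, hκ, hfreq⟩ := exists_pos_frequency ξ hx hy
  have bound : ∀ F : Finset ℤ, (∀ f ∈ F, ∀ g ∈ F, f ≠ g → ¬ IsReturn ξ q (f - g)) →
      (F.card : ℝ) * κ ≤ 2 := by
    intro F hF
    obtain ⟨b, hb⟩ : ∃ b : ℕ, ∀ f ∈ F, f.natAbs ≤ b :=
      ⟨F.sup Int.natAbs, fun f hf => Finset.le_sup hf⟩
    obtain ⟨N, hN, hN'⟩ := (hfreq.and (tendsto_blockLen_diag.eventually_ge_atTop (2 * b))).exists
    have hcard : F.card * (offsets ξ q (N, N)).card ≤ 2 * blockLen (N, N) := by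
      have hinj : Set.InjOn (fun z : ℤ × ℕ => z.1 + (z.2 : ℤ))
          (F ×ˢ offsets ξ q (N, N) : Finset (ℤ × ℕ)) := by
        rintro ⟨f, s⟩ hfs ⟨g, t⟩ hgt h
        simp only [Finset.coe_product, Set.mem_prod, Finset.mem_coe, mem_offsets] at hfs hgt h
        by_cases hfg : f = g
        · subst hfg
          simpa using h
        · exact absurd ⟨_, t, s, hgt.2, hfs.2, by omega⟩ (hF f hfs.1 g hgt.1 hfg)
      rw [← Finset.card_product, ← Finset.card_image_of_injOn hinj]
      have hsub : (F ×ˢ offsets ξ q (N, N)).image (fun z : ℤ × ℕ => z.1 + (z.2 : ℤ)) ⊆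
          Finset.Ico (-(b : ℤ)) (b + blockLen (N, N)) := by
        intro n hn
        obtain ⟨⟨f, s⟩, hfs, rfl⟩ := Finset.mem_image.mp hn
        rw [Finset.mem_product] at hfs
        have h1 := hb f hfs.1
        have h2 := lt_of_mem_offsets hfs.2
        simp only [Finset.mem_Ico]
        omega
      refine (Finset.card_le_card hsub).trans ?_
      rw [Int.card_Ico]
      omega
    have hL : (0 : ℝ) < blockLen (N, N) := by exact_mod_cast blockLen_pos _
    have hcard' : (F.card : ℝ) * (offsets ξ q (N, N)).card ≤ 2 * blockLen (N, N) := by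
      exact_mod_cast hcard
    have : (F.card : ℝ) * κ * blockLen (N, N) ≤ 2 * blockLen (N, N) := by
      rw [mul_assoc]
      exact (mul_le_mul_of_nonneg_left hN (Nat.cast_nonneg _)).trans hcard'
    exact le_of_mul_le_mul_right this hL
  by_contra! hcon
  have large : ∀ k : ℕ, ∃ F : Finset ℤ, F.card = k ∧
      ∀ f ∈ F, ∀ g ∈ F, f ≠ g → ¬ IsReturn ξ q (f - g) := by
    intro k
    induction k with
    | zero => exact ⟨∅, by simp⟩
    | succ k ih =>
      obtain ⟨F, hFk, hF⟩ := ih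
      obtain ⟨n, hn⟩ := hcon F
      have hnF : n ∉ F := fun h => hn n h (by simpa using IsReturn.zero ξ q)
      refine ⟨insert n F, by rw [Finset.card_insert_of_notMem hnF, hFk], ?_⟩
      intro f hf g hg hfg
      rcases Finset.mem_insert.mp hf with hf' | hf' <;>
        rcases Finset.mem_insert.mp hg with hg' | hg'
      · exact absurd (hf'.trans hg'.symm) hfg
      · exact hf' ▸ hn g hg'
      · exact fun h => hn f hf' (by simpa [hg'] using h.neg)
      · exact hF f hf' g hg' hfg
  obtain ⟨k, hk⟩ := exists_nat_gt (2 / κ)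
  obtain ⟨F, hFk, hF⟩ := large k
  have := bound F hF
  rw [hFk, ← le_div_iff₀ hκ] at this
  linarith

theorem ulim_le {f : ℕ → ℝ} {C D : ℝ} (h : ∀ n, |f n| ≤ C) (hD : ∀ᶠ n in atTop, f n ≤ D) :
    ulim f ≤ D :=
  le_of_tendsto (tendsto_ulim h) (eventually_hyperfilter hD)

theorem le_ulim {f : ℕ → ℝ} {C D : ℝ} (h : ∀ n, |f n| ≤ C) (hD : ∀ᶠ n in atTop, D ≤ f n) :
    D ≤ ulim f :=
  ge_of_tendsto (tendsto_ulim h) (eventually_hyperfilter hD)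

theorem ulim_le_add {f g h : ℕ → ℝ} {A B C : ℝ} (hf : ∀ n, |f n| ≤ A) (hg : ∀ n, |g n| ≤ B)
    (hh : ∀ n, |h n| ≤ C) (hle : ∀ n, f n ≤ g n + h n) : ulim f ≤ ulim g + ulim h :=
  le_of_tendsto_of_tendsto' (tendsto_ulim hf) ((tendsto_ulim hg).add (tendsto_ulim hh)) hle

/-- The number of elements of a finite set of integers that a translation moves out of it. -/
def shiftDefect (E : Finset ℤ) (n : ℤ) : ℕ := (E \ E.image (· + n)).card

theorem mem_image_add {E : Finset ℤ} {n z : ℤ} : z ∈ E.image (· + n) ↔ z - n ∈ E := by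
  simp only [Finset.mem_image]
  exact ⟨by rintro ⟨w, hw, rfl⟩; simpa using hw, fun h => ⟨_, h, by ring⟩⟩

theorem card_image_add (E : Finset ℤ) (n : ℤ) : (E.image (· + n)).card = E.card :=
  Finset.card_image_of_injective _ (add_left_injective n)

theorem shiftDefect_le_card (E : Finset ℤ) (n : ℤ) : shiftDefect E n ≤ E.card :=
  Finset.card_le_card Finset.sdiff_subset

theorem shiftDefect_zero (E : Finset ℤ) : shiftDefect E 0 = 0 := by
  simp [shiftDefect]

theorem shiftDefect_neg (E : Finset ℤ) (n : ℤ) : shiftDefect E (-n) = shiftDefect E n := by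
  have h : (E \ E.image (· + -n)).image (· + n) = E.image (· + n) \ E := by
    ext z
    simp only [mem_image_add, Finset.mem_sdiff]
    simp
  rw [shiftDefect, ← card_image_add _ n, h, shiftDefect]
  exact Finset.card_sdiff_comm (card_image_add E n)

theorem shiftDefect_add_le (E : Finset ℤ) (m n : ℤ) :
    shiftDefect E (m + n) ≤ shiftDefect E m + shiftDefect E n := by
  have h : E \ E.image (· + (m + n)) ⊆
      (E \ E.image (· + m)) ∪ (E \ E.image (· + n)).image (· + m) := by
    intro z
    simp only [Finset.mem_union, mem_image_add, Finset.mem_sdiff]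
    rw [show z - (m + n) = z - m - n by ring]
    tauto
  refine (Finset.card_le_card h).trans ((Finset.card_union_le _ _).trans ?_)
  rw [card_image_add]
  rfl

/-- The translates, by positions in the `M`-th diagonal block, of the positions of the block at `p`
in the `N`-th diagonal block. -/
noncomputable def offsetDiff (ξ : ℕ × ℕ → Bool) (p : ℕ × ℕ) (M N : ℕ) : Finset ℤ :=
  Finset.image₂ (fun a t : ℕ => (t : ℤ) - a) (offsets ξ p (M, M)) (offsets ξ p (N, N))

section offsetDiff

variable {ξ : ℕ × ℕ → Bool} {p : ℕ × ℕ}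

theorem mem_offsetDiff {M N : ℕ} {z : ℤ} : z ∈ offsetDiff ξ p M N ↔
    ∃ a t : ℕ, Off ξ p (M, M) a ∧ Off ξ p (N, N) t ∧ (t : ℤ) - a = z := by
  simp only [offsetDiff, Finset.mem_image₂, mem_offsets]
  exact ⟨fun ⟨a, ha, t, ht, h⟩ => ⟨a, t, ha, ht, h⟩, fun ⟨a, t, ha, ht, h⟩ => ⟨a, ha, t, ht, h⟩⟩

theorem card_offsetDiff_le (M N : ℕ) :
    (offsetDiff ξ p M N).card ≤ blockLen (M, M) + blockLen (N, N) := by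
  have hsub : offsetDiff ξ p M N ⊆ Finset.Ico (-(blockLen (M, M) : ℤ)) (blockLen (N, N)) := by
    intro z hz
    obtain ⟨a, t, ha, ht, rfl⟩ := mem_offsetDiff.mp hz
    have := lt_of_mem_offsets (mem_offsets.mpr ha)
    have := lt_of_mem_offsets (mem_offsets.mpr ht)
    simp only [Finset.mem_Ico]
    omega
  refine (Finset.card_le_card hsub).trans ?_
  rw [Int.card_Ico]
  omega

theorem card_offsets_le_card_offsetDiff {M a : ℕ} (h : Off ξ p (M, M) a) (N : ℕ) :
    (offsets ξ p (N, N)).card ≤ (offsetDiff ξ p M N).card := by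
  apply Finset.card_le_card_of_injOn (fun t : ℕ => (t : ℤ) - a)
  · intro t ht
    exact mem_offsetDiff.mpr ⟨a, t, h, mem_offsets.mp ht, rfl⟩
  · intro s _ t _ h
    simpa using h

theorem offsetDiff_image_subset {M M' s : ℕ} (h : Off ξ (M, M) (M', M') s) (N : ℕ) :
    (offsetDiff ξ p M N).image (· + -(s : ℤ)) ⊆ offsetDiff ξ p M' N := by
  intro z hz
  rw [mem_image_add] at hz
  obtain ⟨a, t, ha, ht, h'⟩ := mem_offsetDiff.mp hz
  exact mem_offsetDiff.mpr ⟨a + s, t, ha.trans h, ht, by push_cast; linarith⟩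

theorem shiftDefect_offsetDiff_le {M M' s t : ℕ} (hs : Off ξ (M, M) (M', M') s)
    (ht : Off ξ (M, M) (M', M') t) (N : ℕ) :
    shiftDefect (offsetDiff ξ p M' N) ((s : ℤ) - t) + (offsetDiff ξ p M N).card ≤
      (offsetDiff ξ p M' N).card := by
  have h1 := offsetDiff_image_subset (p := p) ht N
  have h2 := offsetDiff_image_subset (p := p) hs N
  have hsub : offsetDiff ξ p M' N \ (offsetDiff ξ p M' N).image (· + ((s : ℤ) - t)) ⊆
      offsetDiff ξ p M' N \ (offsetDiff ξ p M N).image (· + -(t : ℤ)) := by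
    apply Finset.sdiff_subset_sdiff le_rfl
    intro z hz
    rw [mem_image_add] at hz ⊢
    apply h2
    rw [mem_image_add]
    convert hz using 1
    ring
  have h3 := Finset.card_le_card hsub
  have h4 := Finset.card_sdiff_add_card_eq_card h1
  rw [card_image_add] at h4
  simp only [shiftDefect]
  omega

end offsetDiff

theorem exists_seminorm (ξ : ℕ × ℕ → Bool) {p : ℕ × ℕ} (hx : 1 ≤ p.1) (hy : 1 ≤ p.2) {c : ℤ}
    (hc : ∀ r r', IsReturn ξ p r → IsReturn ξ p r' → r - r' ≠ c) :
    ∃ ρ : ℤ → ℝ, ρ 0 = 0 ∧ (∀ n, ρ (-n) = ρ n) ∧ (∀ m n, ρ (m + n) ≤ ρ m + ρ n) ∧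
      (∀ ε > 0, ∃ M ≥ 1, ∀ r, IsReturn ξ (M, M) r → ρ r ≤ ε) ∧ 0 < ρ c := by
  have hL : ∀ N, (0 : ℝ) < blockLen (N, N) := fun N => by exact_mod_cast blockLen_pos _
  have card_bdd : ∀ M N, |((offsetDiff ξ p M N).card : ℝ) / blockLen (N, N)| ≤
      blockLen (M, M) + 1 := by
    intro M N
    rw [abs_of_nonneg (by positivity), div_le_iff₀ (hL N)]
    have h1 : ((offsetDiff ξ p M N).card : ℝ) ≤ blockLen (M, M) + blockLen (N, N) := by
      exact_mod_cast card_offsetDiff_le M N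
    have h2 : (1 : ℝ) ≤ blockLen (N, N) := by exact_mod_cast blockLen_pos _
    nlinarith [hL M]
  have defect_bdd : ∀ M n N, |(shiftDefect (offsetDiff ξ p M N) n : ℝ) / blockLen (N, N)| ≤
      blockLen (M, M) + 1 := by
    intro M n N
    refine le_trans ?_ (card_bdd M N)
    rw [abs_of_nonneg (by positivity), abs_of_nonneg (by positivity)]
    gcongr
    exact shiftDefect_le_card _ _
  set e : ℕ → ℝ := fun M => ulim fun N => ((offsetDiff ξ p M N).card : ℝ) / blockLen (N, N) with he
  set σ : ℕ → ℤ → ℝ := fun M n =>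
    ulim fun N => (shiftDefect (offsetDiff ξ p M N) n : ℝ) / blockLen (N, N) with hσ
  have card_le_two : ∀ M, ∀ᶠ N in atTop,
      ((offsetDiff ξ p M N).card : ℝ) / blockLen (N, N) ≤ 2 := by
    intro M
    filter_upwards [tendsto_blockLen_diag.eventually_ge_atTop (blockLen (M, M))] with N hN
    rw [div_le_iff₀ (hL N)]
    have := card_offsetDiff_le (ξ := ξ) (p := p) M N
    exact_mod_cast (show (offsetDiff ξ p M N).card ≤ 2 * blockLen (N, N) by omega)
  have e_le : ∀ M, e M ≤ 2 := fun M => ulim_le (card_bdd M) (card_le_two M)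
  have σ_nonneg : ∀ M n, 0 ≤ σ M n := fun M n =>
    le_ulim (defect_bdd M n) (Eventually.of_forall fun N => by positivity)
  have σ_le : ∀ M n, σ M n ≤ 2 := fun M n => ulim_le (defect_bdd M n) <| by
    filter_upwards [card_le_two M] with N hN
    refine le_trans ?_ hN
    gcongr
    exact shiftDefect_le_card _ _
  have σ_bdd : ∀ n M, |σ M n| ≤ 2 := fun n M => by
    rw [abs_of_nonneg (σ_nonneg M n)]
    exact σ_le M n
  have σ_add : ∀ M m n, σ M (m + n) ≤ σ M m + σ M n := fun M m n =>
    ulim_le_add (defect_bdd M _) (defect_bdd M _) (defect_bdd M _) fun N => by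
      rw [← add_div]
      gcongr
      exact_mod_cast shiftDefect_add_le _ _ _
  have σ_add_e : ∀ {M M' s t}, Off ξ (M, M) (M', M') s → Off ξ (M, M) (M', M') t →
      σ M' ((s : ℤ) - t) + e M ≤ e M' := by
    intro M M' s t hs ht
    refine le_of_tendsto_of_tendsto'
      ((tendsto_ulim (defect_bdd M' _)).add (tendsto_ulim (card_bdd M)))
      (tendsto_ulim (card_bdd M')) fun N => ?_
    rw [← add_div]
    gcongr
    exact_mod_cast shiftDefect_offsetDiff_le hs ht N
  refine ⟨fun n => ulim fun M => σ M n, ?_, ?_, ?_, ?_, ?_⟩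
  · have h : ∀ M, σ M 0 = 0 := fun M => le_antisymm
      (ulim_le (defect_bdd M 0) (by simp [shiftDefect_zero])) (σ_nonneg M 0)
    exact le_antisymm (ulim_le (σ_bdd 0) (by simp [h])) (le_ulim (σ_bdd 0) (by simp [h]))
  · intro n
    simp only [hσ, shiftDefect_neg]
  · intro m n
    exact ulim_le_add (σ_bdd _) (σ_bdd _) (σ_bdd _) fun M => σ_add M m n
  · intro ε hε
    set S := e '' Set.Ici 1
    have hS : BddAbove S := ⟨2, by rintro _ ⟨M, -, rfl⟩; exact e_le M⟩
    obtain ⟨_, ⟨M, hM, rfl⟩, hlt⟩ := exists_lt_of_lt_csSup (s := S) ⟨e 1, 1, le_refl 1, rfl⟩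
      (sub_lt_self (sSup S) hε)
    refine ⟨M, hM, ?_⟩
    rintro r ⟨Q, s, t, hs, ht, rfl⟩
    apply ulim_le (σ_bdd _)
    filter_upwards [eventually_ge_atTop (Q.1 + Q.2)] with M' hM'
    have hMQ := hs.le
    simp only [Set.mem_Ici] at hM hMQ
    obtain ⟨w, hw⟩ := Off.exists_of_le (ξ := ξ) (q := Q) (Q := (M', M'))
      (by omega) (by omega) (by simp only; omega) (by simp only; omega)
    have h1 := σ_add_e (hs.trans hw) (ht.trans hw)
    have h2 : e M' ≤ sSup S := le_csSup hS ⟨M', by simp only [Set.mem_Ici]; omega, rfl⟩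
    rw [show ((s + w : ℕ) : ℤ) - ((t + w : ℕ) : ℤ) = (s : ℤ) - t by push_cast; ring] at h1
    linarith
  · obtain ⟨κ, hκ, hfreq⟩ := exists_pos_frequency ξ hx hy
    refine lt_of_lt_of_le hκ (le_ulim (σ_bdd c) ?_)
    filter_upwards [eventually_ge_atTop (p.1 + p.2)] with M hM
    obtain ⟨a, ha⟩ := Off.exists_of_le (ξ := ξ) (q := p) (Q := (M, M))
      hx hy (by simp only; omega) (by simp only; omega)
    apply le_ulim (defect_bdd M c)
    filter_upwards [hfreq] with N hN
    rw [le_div_iff₀ (hL N)]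
    have hdisj : Disjoint (offsetDiff ξ p M N) ((offsetDiff ξ p M N).image (· + c)) := by
      rw [Finset.disjoint_left]
      intro z hz hz'
      rw [mem_image_add] at hz'
      obtain ⟨a, t, ha, ht, h⟩ := mem_offsetDiff.mp hz
      obtain ⟨a', t', ha', ht', h'⟩ := mem_offsetDiff.mp hz'
      exact hc _ _ ⟨_, t, t', ht, ht', rfl⟩ ⟨_, a, a', ha, ha', rfl⟩ (by linarith)
    rw [shiftDefect, Finset.sdiff_eq_self_of_disjoint hdisj]
    exact hN.trans (by exact_mod_cast card_offsets_le_card_offsetDiff ha N)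

/-- Every integer is a difference of two return times of a given interior block. -/
theorem exists_return_sub_return (ξ : ℕ × ℕ → Bool) {p : ℕ × ℕ} (hx : 1 ≤ p.1) (hy : 1 ≤ p.2)
    (c : ℤ) : ∃ r r', IsReturn ξ p r ∧ IsReturn ξ p r' ∧ r - r' = c := by
  by_contra! hcon
  obtain ⟨ρ, h0, hneg, hadd, hret, hpos⟩ := exists_seminorm ξ hx hy (c := c)
    fun r r' hr hr' => hcon r r' hr hr'
  have hsub : ∀ m n, ρ (m - n) ≤ ρ m + ρ n := fun m n => by
    simpa [sub_eq_add_neg, hneg] using hadd m (-n)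
  have htb : ∀ ε > 0, ∃ F : Finset ℤ, ∀ n, ∃ f ∈ F, ρ (n - f) ≤ ε := by
    intro ε hε
    obtain ⟨M, hM, h⟩ := hret ε hε
    obtain ⟨F, hF⟩ := exists_finset_return ξ (q := (M, M)) hM hM
    exact ⟨F, fun n => let ⟨f, hf, hr⟩ := hF n; ⟨f, hf, h _ hr⟩⟩
  obtain ⟨U, hU, hUlarge⟩ := exists_idempotent_ultrafilter_nat
  have recur := choose_recurrence h0 hneg hadd htb U hU
  have one_or : ∀ ε > 0, ∃ M : ℕ, ∀ y ≥ M, ρ 1 ≤ ε ∨ ρ ((y : ℤ) + 2) ≤ ε := by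
    intro ε hε
    obtain ⟨M, hM, hr⟩ := hret (ε / 3) (by positivity)
    refine ⟨M, fun y hy => ?_⟩
    obtain ⟨X, h1, h2, h3, h4, hX⟩ := ((recur (y + 1) (y + 1) (ε / 3) (by positivity)).and
      ((recur (y + 1) (y + 2) (ε / 3) (by positivity)).and
      ((recur (y + 2) (y + 2) (ε / 3) (by positivity)).and
      ((recur y (y + 1) (ε / 3) (by positivity)).and (hUlarge M))))).exists
    obtain ⟨x, rfl⟩ := Nat.exists_eq_add_of_le' (hM.trans hX)
    obtain ⟨r, hbox, hcase⟩ := exists_return_box ξ x y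
    obtain ⟨w, hw⟩ := Off.exists_of_le (ξ := ξ) (q := (M, M)) (Q := (x + 1, y + 1)) hM hM hX
      (by simp only; omega)
    have hρr := hr r (hbox.of_off hw)
    have c1 : (y + 2).choose (y + 1) = y + 2 := Nat.choose_succ_self_right (y + 1)
    have c2 : (y + 1).choose y = y + 1 := Nat.choose_succ_self_right y
    rw [Nat.choose_self] at h1 h3
    rw [c1] at h2
    rw [c2] at h4
    push_cast at h1 h2 h3 h4
    rcases hcase with rfl | rfl | rfl | rfl
    · left
      have := hsub _ _ |>.trans (add_le_add hρr h1)
      rw [sub_sub_cancel] at this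
      linarith
    · right
      have := hsub _ _ |>.trans (add_le_add hρr h2)
      rw [sub_sub_cancel] at this
      linarith
    · left
      have := hsub _ _ |>.trans (add_le_add hρr h3)
      rw [sub_sub_cancel] at this
      linarith
    · right
      have := hsub _ _ |>.trans (add_le_add hρr ((hadd _ _).trans (add_le_add h3 h4)))
      ring_nf at this ⊢
      linarith
  have ρ_one : ∀ ε > 0, ρ 1 ≤ ε := by
    intro ε hε
    obtain ⟨M, hM⟩ := one_or (ε / 2) (by positivity)
    rcases hM M le_rfl with h | h
    · linarith
    rcases hM (M + 1) (by omega) with h' | h'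
    · linarith
    have := hsub _ _ |>.trans (add_le_add h' h)
    push_cast at this
    ring_nf at this ⊢
    linarith
  have ρ_one' : ρ 1 ≤ 0 := le_of_forall_pos_le_add fun ε hε => by simpa using ρ_one ε hε
  have ρ_nat : ∀ n : ℕ, ρ n ≤ 0 := by
    intro n
    induction n with
    | zero => simp [h0]
    | succ n ih =>
      push_cast
      linarith [hadd n 1]
  obtain ⟨n, rfl | rfl⟩ := c.eq_nat_or_neg
  · exact absurd hpos (ρ_nat n).not_gt
  · rw [hneg] at hpos
    exact absurd hpos (ρ_nat n).not_gt

theorem length_segList (ξ : ℕ × ℕ → Bool) : ∀ v, (segList ξ v).length = blockLen v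
  | (0, 0) => by simp [segList, blockLen]
  | (x + 1, 0) => by simpa [segList, blockLen] using length_segList ξ (x, 0)
  | (0, y + 1) => by simpa [segList, blockLen] using length_segList ξ (0, y)
  | (x + 1, y + 1) => by
    have h1 := length_segList ξ (x, y + 1)
    have h2 := length_segList ξ (x + 1, y)
    rw [blockLen_succ, segList]
    split <;> simp [h1, h2, add_comm]
  termination_by v => v.1 + v.2

theorem length_codedBlock (ξ : ℕ × ℕ → Bool) (k : ℕ) :
    ∀ v, (codedBlock ξ k v).length = blockLen v
  | (0, 0) => by rw [codedBlock, length_segList]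
  | (x + 1, 0) => by
    rw [codedBlock]
    split
    · rw [length_segList]
    · simp [blockLen]
  | (0, y + 1) => by
    rw [codedBlock]
    split
    · rw [length_segList]
    · simp [blockLen]
  | (x + 1, y + 1) => by
    have h1 := length_codedBlock ξ k (x, y + 1)
    have h2 := length_codedBlock ξ k (x + 1, y)
    rw [codedBlock]
    split
    · rw [length_segList]
    · rw [blockLen_succ]
      split <;> simp [h1, h2, add_comm]
  termination_by v => v.1 + v.2

/-- The coded basic block as a word over the alphabet `Fin k → Bool`. -/
def blockWord (ξ : ℕ × ℕ → Bool) (k : ℕ) (v : ℕ × ℕ) : List (Fin k → Bool) :=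
  (codedBlock ξ k v).map (segFn k)

@[simp]
theorem length_blockWord (ξ : ℕ × ℕ → Bool) (k : ℕ) (v : ℕ × ℕ) :
    (blockWord ξ k v).length = blockLen v := by
  simp [blockWord, length_codedBlock]

theorem blockWord_succ (ξ : ℕ × ℕ → Bool) {k x y : ℕ} (h : k < x + 1 + (y + 1)) :
    blockWord ξ k (x + 1, y + 1) = if ξ (x + 1, y + 1)
      then blockWord ξ k (x, y + 1) ++ blockWord ξ k (x + 1, y)
      else blockWord ξ k (x + 1, y) ++ blockWord ξ k (x, y + 1) := by
  simp only [blockWord]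
  rw [codedBlock, if_neg h.not_ge]
  split <;> simp

theorem Off.getElem?_blockWord {ξ : ℕ × ℕ → Bool} {k : ℕ} {q Q : ℕ × ℕ} {t : ℕ}
    (h : Off ξ q Q t) (hq : k ≤ q.1 + q.2) {j : ℕ} (hj : j < blockLen q) :
    (blockWord ξ k Q)[t + j]? = (blockWord ξ k q)[j]? := by
  induction h with
  | refl => simp
  | @right x y t h ih =>
    have hle := h.le
    have hlen := h.add_blockLen_le
    simp only at hle
    rw [blockWord_succ ξ (by omega), ← ih]
    split
    · rw [List.getElem?_append_left (by rw [length_blockWord]; omega)]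
      simp
    · rw [List.getElem?_append_right (by rw [length_blockWord]; omega), length_blockWord]
      congr 1
      omega
  | @up x y t h ih =>
    have hle := h.le
    have hlen := h.add_blockLen_le
    simp only at hle
    rw [blockWord_succ ξ (by omega), ← ih]
    split
    · rw [List.getElem?_append_right (by rw [length_blockWord]; omega), length_blockWord]
      congr 1
      omega
    · rw [List.getElem?_append_left (by rw [length_blockWord]; omega)]
      simp

/-- The word `ω_s ⋯ ω_{s+l-1}` occurs in the block at `p` at position `a`. -/
def OccursIn (ξ : ℕ × ℕ → Bool) (k : ℕ) (ω : ℤ → Fin k → Bool) (s : ℤ) (l : ℕ)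
    (p : ℕ × ℕ) (a : ℕ) : Prop :=
  a + l ≤ blockLen p ∧ ∀ j < l, (blockWord ξ k p)[a + j]? = some (ω (s + j))

theorem mem_sigmaK_iff {ξ : ℕ × ℕ → Bool} {k : ℕ} {ω : ℤ → Fin k → Bool} :
    ω ∈ SigmaK ξ k ↔ ∀ s l, ∃ p a, OccursIn ξ k ω s l p a := by
  refine forall_congr' fun s => forall_congr' fun l => exists_congr fun p => ?_
  change _ <:+: blockWord ξ k p ↔ _
  rw [List.infix_iff_getElem?]
  refine exists_congr fun a => ?_
  simp [OccursIn, add_comm, ← List.map_eq_flatMap]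

theorem OccursIn.of_off {ξ : ℕ × ℕ → Bool} {k : ℕ} {ω : ℤ → Fin k → Bool} {s : ℤ} {l : ℕ}
    {p Q : ℕ × ℕ} {a t : ℕ} (h : OccursIn ξ k ω s l p a) (hp : k ≤ p.1 + p.2)
    (ht : Off ξ p Q t) : OccursIn ξ k ω s l Q (t + a) := by
  have := ht.add_blockLen_le
  have := h.1
  refine ⟨by omega, fun j hj => ?_⟩
  rw [add_assoc, ht.getElem?_blockWord hp (by omega), h.2 j hj]

/-- A long word can only occur in an interior block of level at least `k`. -/
theorem interior_of_lt_blockLen {k : ℕ} {p : ℕ × ℕ} (h : 2 ^ k < blockLen p) :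
    1 ≤ p.1 ∧ 1 ≤ p.2 ∧ k ≤ p.1 + p.2 := by
  have h1 : 1 < blockLen p := lt_of_le_of_lt Nat.one_le_two_pow h
  refine ⟨?_, ?_, ?_⟩
  · by_contra h0
    simp [blockLen, show p.1 = 0 by omega] at h1
  · by_contra h0
    simp [blockLen, show p.2 = 0 by omega] at h1
  · exact ((Nat.pow_lt_pow_iff_right one_lt_two).1
      (h.trans_le (Nat.choose_le_two_pow _ _))).le

theorem shift_mem_sigmaK {ξ : ℕ × ℕ → Bool} {k : ℕ} {ω : ℤ → Fin k → Bool}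
    (h : ω ∈ SigmaK ξ k) (n : ℤ) : (fun u => ω (u + n)) ∈ SigmaK ξ k := by
  intro s l
  obtain ⟨p, hp⟩ := h (s + n) l
  refine ⟨p, ?_⟩
  convert hp using 4
  ring

/-- Every interior block of level at least `k` can be extended to a point of the subshift. -/
theorem exists_mem_sigmaK (ξ : ℕ × ℕ → Bool) {k : ℕ} {q : ℕ × ℕ} (hx : 1 ≤ q.1) (hy : 1 ≤ q.2)
    (hk : k ≤ q.1 + q.2) (i : ℤ) :
    ∃ ω ∈ SigmaK ξ k, ∀ j < blockLen q, (blockWord ξ k q)[j]? = some (ω (i + j)) := by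
  obtain ⟨x, y⟩ := q
  obtain ⟨x, rfl⟩ := Nat.exists_eq_add_of_le' hx
  obtain ⟨y, rfl⟩ := Nat.exists_eq_add_of_le' hy
  simp only at hk
  let R : ℕ → ℕ × ℕ := fun m => (x + 2 * m + 1, y + 2 * m + 1)
  have step (m : ℕ) : ∃ t, Off ξ (R m) (R (m + 1)) t ∧ 1 ≤ t ∧
      t + blockLen (R m) + 1 ≤ blockLen (R (m + 1)) := Off.exists_strictly_inside _ _
  choose t hoff ht hlen using step
  let o : ℕ → ℕ := fun m => ∑ n ∈ Finset.range m, t n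
  have o_succ (m : ℕ) : o (m + 1) = o m + t m := Finset.sum_range_succ _ _
  have o_ge (m : ℕ) : m ≤ o m := by
    induction m with
    | zero => simp
    | succ m ih => rw [o_succ]; linarith [ht m]
  have o_le (m : ℕ) : o m + m < blockLen (R m) := by
    induction m with
    | zero => simpa [o] using blockLen_pos _
    | succ m ih => rw [o_succ]; linarith [hlen m]
  have off {m m' : ℕ} (h : m ≤ m') : ∃ d, o m' = o m + d ∧ Off ξ (R m) (R m') d := by
    induction m', h using Nat.le_induction with
    | base => exact ⟨0, rfl, .refl⟩
    | succ m' _ ih =>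
      obtain ⟨d, hd, h⟩ := ih
      exact ⟨d + t m', by rw [o_succ, hd, add_assoc], h.trans (hoff m')⟩
  have compat {m m' : ℕ} (h : m ≤ m') (z : ℤ) (h1 : 0 ≤ z + o m)
      (h2 : z + o m < blockLen (R m)) :
      (blockWord ξ k (R m'))[(z + o m').toNat]? = (blockWord ξ k (R m))[(z + o m).toNat]? := by
    obtain ⟨d, hd, h⟩ := off h
    rw [← h.getElem?_blockWord (by simp only [R]; omega) (by omega)]
    congr 1
    omega
  let N : ℤ → ℕ := fun z => z.natAbs
  let ω : ℤ → Fin k → Bool := fun z =>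
    ((blockWord ξ k (R (N (z - i))))[(z - i + o (N (z - i))).toNat]?).getD default
  have key (m : ℕ) (z : ℤ) (h1 : 0 ≤ z - i + o m) (h2 : z - i + o m < blockLen (R m)) :
      (blockWord ξ k (R m))[(z - i + o m).toNat]? = some (ω z) := by
    have hN : N (z - i) = (z - i).natAbs := rfl
    have a1 := o_ge (N (z - i))
    have a2 := o_le (N (z - i))
    have e : (blockWord ξ k (R m))[(z - i + o m).toNat]? =
        (blockWord ξ k (R (N (z - i))))[(z - i + o (N (z - i))).toNat]? := by
      rcases le_total m (N (z - i)) with h | h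
      · exact (compat h _ h1 h2).symm
      · exact compat h _ (by omega) (by omega)
    rw [e]
    simp only [ω]
    rw [List.getElem?_eq_getElem (by rw [length_blockWord]; omega)]
    rfl
  refine ⟨ω, mem_sigmaK_iff.2 fun s l => ?_, fun j hj => ?_⟩
  · have a1 := o_ge ((s - i).natAbs + l)
    have a2 := o_le ((s - i).natAbs + l)
    refine ⟨R ((s - i).natAbs + l), (s - i + o ((s - i).natAbs + l)).toNat, by omega,
      fun j hj => ?_⟩
    rw [← key ((s - i).natAbs + l) _ (by omega) (by omega)]
    congr 1
    omega
  · have := key 0 (i + j) (by simp [o]) (by simpa [o, R] using hj)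
    simpa [o, R] using this

/-- A long window of a point placed in a larger block is realised by a point of the subshift. -/
theorem exists_mem_sigmaK_agree {ξ : ℕ × ℕ → Bool} {k : ℕ} {ω ω' : ℤ → Fin k → Bool} {s s' : ℤ}
    {l a b : ℕ} {Q : ℕ × ℕ} (hl : 2 ^ k < l) (h : OccursIn ξ k ω s l Q a)
    (h' : OccursIn ξ k ω' s' l Q b) :
    ∃ η ∈ SigmaK ξ k, (∀ j < l, η (s + j) = ω (s + j)) ∧
      ∀ j < l, η (s - a + b + j) = ω' (s' + j) := by
  have h1 := h.1
  have h1' := h'.1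
  obtain ⟨hx, hy, hk⟩ := interior_of_lt_blockLen (k := k) (p := Q) (by omega)
  obtain ⟨η, hη, e⟩ := exists_mem_sigmaK ξ hx hy hk (s - a)
  refine ⟨η, hη, fun j hj => ?_, fun j hj => ?_⟩
  · have := e (a + j) (by omega)
    rw [h.2 j hj, Option.some_inj] at this
    rw [this]
    congr 1
    push_cast
    ring
  · have := e (b + j) (by omega)
    rw [h'.2 j hj, Option.some_inj] at this
    rw [this]
    congr 1
    push_cast
    ring

theorem exists_window {A : Type*} [TopologicalSpace A] {U : Set ((ℤ → A) × (ℤ → A))}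
    (hU : IsOpen U) {ω : (ℤ → A) × (ℤ → A)} (hω : ω ∈ U) :
    ∃ L : ℕ, ∀ η : (ℤ → A) × (ℤ → A),
      (∀ z : ℤ, z.natAbs ≤ L → η.1 z = ω.1 z ∧ η.2 z = ω.2 z) → η ∈ U := by
  obtain ⟨u, v, hu, hv, h1, h2, huv⟩ := isOpen_prod_iff.1 hU ω.1 ω.2 hω
  obtain ⟨I, f, hf, hI⟩ := isOpen_pi_iff.1 hu _ h1
  obtain ⟨J, g, hg, hJ⟩ := isOpen_pi_iff.1 hv _ h2
  refine ⟨(I ∪ J).sup Int.natAbs, fun η h => huv ⟨hI fun z hz => ?_, hJ fun z hz => ?_⟩⟩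
  · rw [(h z (Finset.le_sup (f := Int.natAbs) (Finset.mem_union_left J hz))).1]
    exact (hf z hz).2
  · rw [(h z (Finset.le_sup (f := Int.natAbs) (Finset.mem_union_right I hz))).2]
    exact (hg z hz).2

end

theorem stmt9 (ξ : ℕ × ℕ → Bool) (k : ℕ) (hk : 1 ≤ k) :
    ∀ U V : Set ((ℤ → (Fin k → Bool)) × (ℤ → (Fin k → Bool))),
      IsOpen U → IsOpen V →
      (U ∩ (SigmaK ξ k) ×ˢ (SigmaK ξ k)).Nonempty →
      (V ∩ (SigmaK ξ k) ×ˢ (SigmaK ξ k)).Nonempty →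
      ∃ n : ℤ, ∃ ω ∈ U ∩ (SigmaK ξ k) ×ˢ (SigmaK ξ k),
        ((fun u => ω.1 (u + n), fun u => ω.2 (u + n)) : (ℤ → (Fin k → Bool)) × (ℤ → (Fin k → Bool)))
          ∈ V ∩ (SigmaK ξ k) ×ˢ (SigmaK ξ k) := by
  rintro U V hU hV ⟨ω, hωU, hω1, hω2⟩ ⟨η, hηV, hη1, hη2⟩
  obtain ⟨L, hL⟩ := exists_window hU hωU
  obtain ⟨M, hM⟩ := exists_window hV hηV
  have hk0 := Nat.two_pow_pos k
  obtain ⟨K, hK1, hK2, hK3⟩ : ∃ K, L ≤ K ∧ M ≤ K ∧ 2 ^ k ≤ K :=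
    ⟨L + M + 2 ^ k, by lia, by lia, by lia⟩
  set l := 2 * K + 1 with hl
  have hkl : 2 ^ k < l := by omega
  obtain ⟨p₁, a₁, h₁⟩ := mem_sigmaK_iff.1 hω1 (-K) l
  obtain ⟨p₂, a₂, h₂⟩ := mem_sigmaK_iff.1 hω2 (-K) l
  obtain ⟨p₃, a₃, h₃⟩ := mem_sigmaK_iff.1 hη1 (-K) l
  obtain ⟨p₄, a₄, h₄⟩ := mem_sigmaK_iff.1 hη2 (-K) l
  have lift {ω : ℤ → Fin k → Bool} {p : ℕ × ℕ} {a : ℕ} (h : OccursIn ξ k ω (-K) l p a)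
      (hp : p ≤ p₁ ⊔ p₂ ⊔ (p₃ ⊔ p₄)) :
      ∃ b, OccursIn ξ k ω (-K) l (p₁ ⊔ p₂ ⊔ (p₃ ⊔ p₄)) b := by
    have := h.1
    obtain ⟨hx, hy, hkp⟩ := interior_of_lt_blockLen (k := k) (p := p) (by omega)
    obtain ⟨t, ht⟩ := Off.exists_of_le (ξ := ξ) hx hy hp.1 hp.2
    exact ⟨_, h.of_off hkp ht⟩
  obtain ⟨a₁, h₁⟩ := lift h₁ (le_sup_left.trans le_sup_left)
  obtain ⟨a₂, h₂⟩ := lift h₂ (le_sup_right.trans le_sup_left)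
  obtain ⟨a₃, h₃⟩ := lift h₃ (le_sup_left.trans le_sup_right)
  obtain ⟨a₄, h₄⟩ := lift h₄ (le_sup_right.trans le_sup_right)
  generalize p₁ ⊔ p₂ ⊔ (p₃ ⊔ p₄) = p at h₁ h₂ h₃ h₄
  have := h₁.1
  obtain ⟨hx, hy, hkp⟩ := interior_of_lt_blockLen (k := k) (p := p) (by omega)
  obtain ⟨_, _, ⟨Q, s', s, hs', hs, rfl⟩, ⟨Q', t', t, ht', ht, rfl⟩, e⟩ :=
    exists_return_sub_return ξ hx hy ((a₄ : ℤ) - a₂ - a₃ + a₁)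
  obtain ⟨θ₁, hθ₁, hU₁, hV₁⟩ := exists_mem_sigmaK_agree hkl (h₁.of_off hkp hs)
    (h₃.of_off hkp hs')
  obtain ⟨θ₂, hθ₂, hU₂, hV₂⟩ := exists_mem_sigmaK_agree hkl (h₂.of_off hkp ht)
    (h₄.of_off hkp ht')
  refine ⟨(s' : ℤ) + a₃ - (s + a₁), (θ₁, θ₂), ⟨hL _ fun z hz => ?_, hθ₁, hθ₂⟩,
    ⟨hM _ fun z hz => ?_, shift_mem_sigmaK hθ₁ _, shift_mem_sigmaK hθ₂ _⟩⟩
  · have e1 := hU₁ (z + K).toNat (by omega)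
    have e2 := hU₂ (z + K).toNat (by omega)
    rw [show (-K : ℤ) + (z + K).toNat = z by omega] at e1 e2
    exact ⟨e1, e2⟩
  · have e1 := hV₁ (z + K).toNat (by omega)
    have e2 := hV₂ (z + K).toNat (by omega)
    rw [show (-K : ℤ) + (z + K).toNat = z by omega] at e1 e2
    rw [show (-K : ℤ) - (s + a₁ : ℕ) + (s' + a₃ : ℕ) + (z + K).toNat =
      z + ((s' : ℤ) + a₃ - (s + a₁)) by push_cast; omega] at e1
    rw [show (-K : ℤ) - (t + a₂ : ℕ) + (t' + a₄ : ℕ) + (z + K).toNat =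
      z + ((s' : ℤ) + a₃ - (s + a₁)) by push_cast; omega] at e2
    exact ⟨e1, e2⟩
end

section
/- The big subshift Σ is not topologically transitive: there is no point ω ∈ Σ whose shift orbit {σ^n ω : n ∈ ℤ} is dense in Σ. -/
lemma basicBlock_row_zero (ξ : ℕ × ℕ → Bool) (x : ℕ) : basicBlock ξ (x + 1, 0) = [false] := by
  rw [basicBlock]

lemma basicBlock_col_zero (ξ : ℕ × ℕ → Bool) (y : ℕ) : basicBlock ξ (0, y + 1) = [true] := by
  rw [basicBlock]

lemma basicBlock_succ_succ (ξ : ℕ × ℕ → Bool) (x y : ℕ) :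
    basicBlock ξ (x + 1, y + 1) =
      if ξ (x + 1, y + 1) then basicBlock ξ (x, y + 1) ++ basicBlock ξ (x + 1, y)
      else basicBlock ξ (x + 1, y) ++ basicBlock ξ (x, y + 1) := by
  rw [basicBlock]

/-- Complementing the ordering reverses every basic block. -/
lemma basicBlock_compl (ξ : ℕ × ℕ → Bool) (x y : ℕ) :
    basicBlock (fun v => !ξ v) (x, y) = (basicBlock ξ (x, y)).reverse := by
  induction x generalizing y with
  | zero =>
    cases y with
    | zero => simp [basicBlock]
    | succ y => simp [basicBlock_col_zero]
  | succ x ihx =>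
    induction y with
    | zero => simp [basicBlock_row_zero]
    | succ y ihy =>
      rw [basicBlock_succ_succ, basicBlock_succ_succ, ihx, ihy]
      cases ξ (x + 1, y + 1) <;> simp

/-- The blocks in the first row are `a^p b a^q`, with exponents growing with the row index. -/
lemma basicBlock_row_one (ξ : ℕ × ℕ → Bool) {m p₀ q₀ : ℕ}
    (h : basicBlock ξ (m, 1) = List.replicate p₀ false ++ true :: List.replicate q₀ false)
    (k : ℕ) : ∃ p q, p₀ ≤ p ∧ q₀ ≤ q ∧
      basicBlock ξ (m + k, 1) = List.replicate p false ++ true :: List.replicate q false := by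
  induction k with
  | zero => exact ⟨p₀, q₀, le_rfl, le_rfl, h⟩
  | succ k ih =>
    obtain ⟨p, q, hp, hq, e⟩ := ih
    rw [← add_assoc, basicBlock_succ_succ, e, basicBlock_row_zero]
    cases ξ (m + k + 1, 0 + 1)
    · exact ⟨p + 1, q, by omega, hq, by simp [List.replicate_succ]⟩
    · exact ⟨p, q + 1, hp, by omega, by simp [List.replicate_succ']⟩

/-- The blocks in the first column are `b^p a b^q`, with exponents growing with the column index. -/
lemma basicBlock_col_one (ξ : ℕ × ℕ → Bool) {m p₀ q₀ : ℕ}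
    (h : basicBlock ξ (1, m) = List.replicate p₀ true ++ false :: List.replicate q₀ true)
    (k : ℕ) : ∃ p q, p₀ ≤ p ∧ q₀ ≤ q ∧
      basicBlock ξ (1, m + k) = List.replicate p true ++ false :: List.replicate q true := by
  induction k with
  | zero => exact ⟨p₀, q₀, le_rfl, le_rfl, h⟩
  | succ k ih =>
    obtain ⟨p, q, hp, hq, e⟩ := ih
    rw [← add_assoc, basicBlock_succ_succ, e, basicBlock_col_zero]
    cases ξ (0 + 1, m + k + 1)
    · exact ⟨p, q + 1, hp, by omega, by simp [List.replicate_succ']⟩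
    · exact ⟨p + 1, q, by omega, hq, by simp [List.replicate_succ]⟩

/-- A property of words stable under concatenation that holds on the first row and column beyond
`(1,1)` holds for all basic blocks at interior vertices other than `(1,1)`. -/
lemma basicBlock_induction (ξ : ℕ × ℕ → Bool) {P : List Bool → Prop}
    (append : ∀ u v, P u → P v → P (u ++ v))
    (row : ∀ k, P (basicBlock ξ (2 + k, 1))) (col : ∀ k, P (basicBlock ξ (1, 2 + k)))
    (x y : ℕ) (h : 1 ≤ x + y) : P (basicBlock ξ (x + 1, y + 1)) := by
  induction x generalizing y with
  | zero =>
    obtain ⟨k, rfl⟩ : ∃ k, y = 1 + k := Nat.exists_eq_add_of_le (by omega)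
    simpa [add_comm, add_left_comm, ← add_assoc] using col k
  | succ x ihx =>
    induction y with
    | zero => simpa [add_comm, add_left_comm, ← add_assoc] using row x
    | succ y ihy =>
      have h₁ := ihx (y + 1) (by omega)
      have h₂ := ihy (by omega)
      rw [basicBlock_succ_succ]
      split
      · exact append _ _ h₁ h₂
      · exact append _ _ h₂ h₁

/-- Runs of a nondeterministic automaton over the alphabet `Bool`. -/
def HasRun {n : ℕ} (δ : Fin n → Bool → Fin n → Bool) : List Bool → Fin n → Fin n → Prop
  | [], s, t => s = t
  | c :: w, s, t => ∃ r, δ s c r = true ∧ HasRun δ w r t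

instance HasRun.decidable {n : ℕ} (δ : Fin n → Bool → Fin n → Bool) :
    ∀ (w : List Bool) (s t : Fin n), Decidable (HasRun δ w s t)
  | [], s, t => inferInstanceAs (Decidable (s = t))
  | c :: w, s, t =>
    have := HasRun.decidable δ w
    inferInstanceAs (Decidable (∃ r, δ s c r = true ∧ HasRun δ w r t))

lemma hasRun_append {n : ℕ} {δ : Fin n → Bool → Fin n → Bool} {u v : List Bool} {s t : Fin n} :
    HasRun δ (u ++ v) s t ↔ ∃ r, HasRun δ u s r ∧ HasRun δ v r t := by
  induction u generalizing s with
  | nil => simp [HasRun]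
  | cons c u ih =>
    simp only [List.cons_append, HasRun, ih]
    constructor
    · rintro ⟨r, h, r', h₁, h₂⟩
      exact ⟨r', ⟨r, h, h₁⟩, h₂⟩
    · rintro ⟨r', ⟨r, h, h₁⟩, h₂⟩
      exact ⟨r, h, r', h₁, h₂⟩

lemma HasRun.of_infix {n : ℕ} {δ : Fin n → Bool → Fin n → Bool} {u w : List Bool} {s t : Fin n}
    (h : HasRun δ w s t) (hu : u <:+: w) : ∃ s' t', HasRun δ u s' t' := by
  obtain ⟨l, r, rfl⟩ := hu
  obtain ⟨t', h₁, -⟩ := hasRun_append.1 h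
  obtain ⟨s', -, h₂⟩ := hasRun_append.1 h₁
  exact ⟨s', t', h₂⟩

lemma hasRun_replicate {n : ℕ} {δ : Fin n → Bool → Fin n → Bool} {c : Bool} {s : Fin n}
    (h : δ s c s = true) (k : ℕ) : HasRun δ (List.replicate k c) s s := by
  induction k with
  | zero => rfl
  | succ k ih => exact ⟨s, h, ih⟩

lemma hasRun_replicate_enter {n : ℕ} {δ : Fin n → Bool → Fin n → Bool} {c : Bool} {s t : Fin n}
    (h : δ s c t = true) (h' : δ t c t = true) {k : ℕ} (hk : 1 ≤ k) :
    HasRun δ (List.replicate k c) s t := by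
  obtain ⟨k, rfl⟩ := Nat.exists_eq_add_of_le' hk
  exact ⟨t, h, hasRun_replicate h' k⟩

lemma hasRun_replicate_exit {n : ℕ} {δ : Fin n → Bool → Fin n → Bool} {c : Bool} {s t : Fin n}
    (h : δ s c t = true) (h' : δ s c s = true) {k : ℕ} (hk : 1 ≤ k) :
    HasRun δ (List.replicate k c) s t := by
  obtain ⟨k, rfl⟩ := Nat.exists_eq_add_of_le' hk
  rw [List.replicate_succ', hasRun_append]
  exact ⟨s, hasRun_replicate h' k, t, h, rfl⟩

lemma hasRun_append_cons {n : ℕ} {δ : Fin n → Bool → Fin n → Bool} {u v : List Bool} {c : Bool}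
    {s t : Fin n} (r r' : Fin n) (h₁ : HasRun δ u s r) (h₂ : δ r c r' = true)
    (h₃ : HasRun δ v r' t) : HasRun δ (u ++ c :: v) s t :=
  hasRun_append.2 ⟨r, h₁, r', h₂, h₃⟩

/-- Automaton for concatenations of words from `a⁺ba⁺ ∪ b⁺ab*`. -/
def autoRow (s : Fin 5) (c : Bool) (t : Fin 5) : Bool :=
  ((s, c, t) : Fin 5 × Bool × Fin 5) ∈
    [(0, false, 1), (1, false, 1), (1, true, 2), (2, false, 2), (2, false, 0),
     (0, true, 3), (3, true, 3), (3, false, 0), (3, false, 4), (4, true, 4), (4, true, 0)]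

/-- Automaton for concatenations of words from `a*ba⁺ ∪ b⁺ab⁺`. -/
def autoCol (s : Fin 5) (c : Bool) (t : Fin 5) : Bool :=
  ((s, c, t) : Fin 5 × Bool × Fin 5) ∈
    [(0, false, 1), (1, false, 1), (1, true, 2), (0, true, 2), (2, false, 2), (2, false, 0),
     (0, true, 3), (3, true, 3), (3, false, 4), (4, true, 4), (4, true, 0)]

/-- Automaton for concatenations of words from `a*baa⁺ ∪ bb⁺ab*`. -/
def autoBoth (s : Fin 7) (c : Bool) (t : Fin 7) : Bool :=
  ((s, c, t) : Fin 7 × Bool × Fin 7) ∈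
    [(0, false, 1), (1, false, 1), (1, true, 2), (0, true, 2), (2, false, 5), (5, false, 5),
     (5, false, 0), (0, true, 6), (6, true, 3), (3, true, 3), (3, false, 0), (3, false, 4),
     (4, true, 4), (4, true, 0)]

lemma autoRow_avoids : ∀ s t, ¬ HasRun autoRow [true, true, false, false, true, true] s t := by
  decide

lemma autoCol_avoids : ∀ s t, ¬ HasRun autoCol [false, false, true, true, false, false] s t := by
  decide

lemma autoBoth_avoids : ∀ s t, ¬ HasRun autoBoth [false, false, true, false, true] s t := by
  decide

/-- If the automaton `δ` accepts the first row and column beyond `(1,1)` and has no run on `u`,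
then no basic block contains `u`. -/
lemma not_infix_basicBlock_of_hasRun (ξ : ℕ × ℕ → Bool) {n : ℕ}
    {δ : Fin n → Bool → Fin n → Bool} {u : List Bool} (s : Fin n) (hu : 3 ≤ u.length)
    (avoid : ∀ s t, ¬ HasRun δ u s t)
    (row : ∀ k, HasRun δ (basicBlock ξ (2 + k, 1)) s s)
    (col : ∀ k, HasRun δ (basicBlock ξ (1, 2 + k)) s s) (v : ℕ × ℕ) :
    ¬ u <:+: basicBlock ξ v := by
  intro h
  have hle := h.length_le
  obtain ⟨_ | x, _ | y⟩ := v
  · rw [basicBlock, List.length_nil] at hle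
    omega
  · simp [basicBlock_col_zero] at hle
    omega
  · simp [basicBlock_row_zero] at hle
    omega
  · rcases Nat.eq_zero_or_pos (x + y) with h0 | h0
    · obtain ⟨rfl, rfl⟩ : x = 0 ∧ y = 0 := by omega
      have : (basicBlock ξ (0 + 1, 0 + 1)).length = 2 := by
        rw [basicBlock_succ_succ, basicBlock_row_zero, basicBlock_col_zero]
        split <;> rfl
      omega
    · have := basicBlock_induction ξ (P := fun w => HasRun δ w s s)
        (fun a b ha hb => hasRun_append.2 ⟨s, ha, hb⟩) row col x y h0
      obtain ⟨s', t', hr⟩ := this.of_infix h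
      exact avoid s' t' hr

/-- The word `aabaabbaababbaabbabb`, which is the block at `(3,3)` for a suitable ordering. -/
def markerWord : List Bool :=
  [false, false, true, false, false, true, true, false, false, true,
   false, true, true, false, false, true, true, false, true, true]

lemma not_markerWord_infix (ξ : ℕ × ℕ → Bool) (hξ : ξ (1, 1) = true) (v : ℕ × ℕ) :
    ¬ markerWord <:+: basicBlock ξ v := by
  have h11 : basicBlock ξ (1, 1) = [true, false] := by
    rw [basicBlock_succ_succ, basicBlock_row_zero, basicBlock_col_zero]
    simp [hξ]
  have h21 : basicBlock ξ (2, 1) = if ξ (2, 1) then [true, false, false]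
      else [false, true, false] := by
    rw [basicBlock_succ_succ, basicBlock_row_zero, h11]
    rfl
  have h12 : basicBlock ξ (1, 2) = if ξ (1, 2) then [true, true, false]
      else [true, false, true] := by
    rw [basicBlock_succ_succ, basicBlock_col_zero, h11]
    rfl
  have row₁ := basicBlock_row_one ξ (m := 1) (p₀ := 0) (q₀ := 1) h11
  have col₁ := basicBlock_col_one ξ (m := 1) (p₀ := 1) (q₀ := 0) h11
  intro h
  cases hr : ξ (2, 1) with
  | false =>
    refine not_infix_basicBlock_of_hasRun ξ 0 (by simp) autoRow_avoids ?_ ?_ v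
      (List.IsInfix.trans (by decide) h)
    · intro k
      obtain ⟨p, q, hp, hq, e⟩ := basicBlock_row_one ξ (m := 2) (p₀ := 1) (q₀ := 1)
        (by rw [h21, hr]; rfl) k
      rw [e]
      exact hasRun_append_cons 1 2 (hasRun_replicate_enter rfl rfl hp) rfl
        (hasRun_replicate_exit rfl rfl hq)
    · intro k
      obtain ⟨p, q, hp, -, e⟩ := col₁ (1 + k)
      rw [show 2 + k = 1 + (1 + k) by omega, e]
      rcases Nat.eq_zero_or_pos q with rfl | hq
      · exact hasRun_append_cons 3 0 (hasRun_replicate_enter rfl rfl hp) rfl rfl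
      · exact hasRun_append_cons 3 4 (hasRun_replicate_enter rfl rfl hp) rfl
          (hasRun_replicate_exit rfl rfl hq)
  | true =>
    cases hc : ξ (1, 2) with
    | false =>
      refine not_infix_basicBlock_of_hasRun ξ 0 (by simp) autoCol_avoids ?_ ?_ v
        (List.IsInfix.trans (by decide) h)
      · intro k
        obtain ⟨p, q, -, hq, e⟩ := row₁ (1 + k)
        rw [show 2 + k = 1 + (1 + k) by omega, e]
        rcases Nat.eq_zero_or_pos p with rfl | hp
        · exact hasRun_append_cons 0 2 rfl rfl (hasRun_replicate_exit rfl rfl hq)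
        · exact hasRun_append_cons 1 2 (hasRun_replicate_enter rfl rfl hp) rfl
            (hasRun_replicate_exit rfl rfl hq)
      · intro k
        obtain ⟨p, q, hp, hq, e⟩ := basicBlock_col_one ξ (m := 2) (p₀ := 1) (q₀ := 1)
          (by rw [h12, hc]; rfl) k
        rw [e]
        exact hasRun_append_cons 3 4 (hasRun_replicate_enter rfl rfl hp) rfl
          (hasRun_replicate_exit rfl rfl hq)
    | true =>
      refine not_infix_basicBlock_of_hasRun ξ 0 (by simp) autoBoth_avoids ?_ ?_ v
        (List.IsInfix.trans (by decide) h)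
      · intro k
        obtain ⟨p, q, -, hq, e⟩ := basicBlock_row_one ξ (m := 2) (p₀ := 0) (q₀ := 2)
          (by rw [h21, hr]; rfl) k
        obtain ⟨q, rfl⟩ := Nat.exists_eq_add_of_le' (show 1 ≤ q by omega)
        have run : HasRun autoBoth (List.replicate (q + 1) false) 2 0 :=
          ⟨5, rfl, hasRun_replicate_exit rfl rfl (by omega)⟩
        rw [e]
        rcases Nat.eq_zero_or_pos p with rfl | hp
        · exact hasRun_append_cons 0 2 rfl rfl run
        · exact hasRun_append_cons 1 2 (hasRun_replicate_enter rfl rfl hp) rfl run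
      · intro k
        obtain ⟨p, q, hp, -, e⟩ := basicBlock_col_one ξ (m := 2) (p₀ := 2) (q₀ := 0)
          (by rw [h12, hc]; rfl) k
        obtain ⟨p, rfl⟩ := Nat.exists_eq_add_of_le' (show 1 ≤ p by omega)
        have run : HasRun autoBoth (List.replicate (p + 1) true) 0 3 :=
          ⟨6, rfl, hasRun_replicate_enter rfl rfl (by omega)⟩
        rw [e]
        rcases Nat.eq_zero_or_pos q with rfl | hq
        · exact hasRun_append_cons 3 0 run rfl rfl
        · exact hasRun_append_cons 3 4 run rfl (hasRun_replicate_exit rfl rfl hq)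

lemma not_reverse_markerWord_infix (ξ : ℕ × ℕ → Bool) (hξ : ξ (1, 1) = false) (v : ℕ × ℕ) :
    ¬ markerWord.reverse <:+: basicBlock ξ v := by
  intro h
  apply not_markerWord_infix (fun v => !ξ v) (by simp [hξ]) v
  rw [basicBlock_compl ξ v.1 v.2, ← List.reverse_infix, List.reverse_reverse]
  exact h

/-- A sequence of words growing on both sides converges to a bi-infinite word. -/
lemma exists_biinfinite_limit {α : Type*} [Inhabited α] (V L R : ℕ → List α)
    (hV : ∀ n, V (n + 1) = L n ++ V n ++ R n) (hL : ∀ n, L n ≠ []) (hR : ∀ n, R n ≠ []) :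
    ∃ (ω : ℤ → α) (o : ℕ → ℤ), (∀ n : ℕ, (n : ℤ) ≤ o n ∧ (n : ℤ) ≤ (V n).length - o n) ∧
      ∀ n, V n = (List.range (V n).length).map fun u : ℕ => ω (-o n + u) := by
  let o : ℕ → ℕ := fun n => ∑ i ∈ Finset.range n, (L i).length
  have o_succ (n : ℕ) : o (n + 1) = o n + (L n).length := Finset.sum_range_succ _ _
  have bounds (n : ℕ) : n ≤ o n ∧ n + o n ≤ (V n).length := by
    induction n with
    | zero => simp [o]
    | succ n ih =>
      have h₁ := List.length_pos_iff.2 (hL n)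
      have h₂ := List.length_pos_iff.2 (hR n)
      have h₃ := o_succ n
      have h₄ : (V (n + 1)).length = (L n).length + (V n).length + (R n).length := by
        simp [hV, add_assoc]
      omega
  have stable (n k i : ℕ) (hi : i < (V n).length) :
      (V (n + k))[o (n + k) - o n + i]? = (V n)[i]? ∧ o n ≤ o (n + k) ∧
        o (n + k) - o n + i < (V (n + k)).length := by
    induction k with
    | zero => simpa using hi
    | succ k ih =>
      obtain ⟨h₁, h₂, h₃⟩ := ih
      have h₄ := o_succ (n + k)
      have h₅ : (V (n + k + 1)).length =
          (L (n + k)).length + (V (n + k)).length + (R (n + k)).length := by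
        rw [hV]
        simp only [List.length_append]
      rw [← add_assoc n k 1]
      refine ⟨?_, by omega, by omega⟩
      rw [hV, List.getElem?_append_left (by simp; omega), List.getElem?_append_right (by omega),
        ← h₁]
      congr 1
      omega
  refine ⟨fun t => (V (t.natAbs + 1))[(t + o (t.natAbs + 1)).toNat]?.getD default,
    fun n => o n, fun n => ?_, fun n => ?_⟩
  · have := bounds n
    constructor <;> simp only <;> omega
  · apply List.ext_getElem?
    intro i
    rcases lt_or_ge i (V n).length with hi | hi
    · rw [List.getElem?_map, List.getElem?_range hi, Option.map_some]
      simp only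
      generalize ht : (-(o n : ℤ) + i) = t
      set m := t.natAbs + 1 with hm
      have hb := bounds m
      have key : (V m)[(t + o m).toNat]? = (V n)[i]? := by
        rcases le_total n m with hnm | hnm
        · obtain ⟨k, hk⟩ := Nat.exists_eq_add_of_le hnm
          obtain ⟨h₁, h₂, -⟩ := stable n k i hi
          rw [← h₁, hk]
          congr 1
          rw [← ht]
          omega
        · obtain ⟨k, hk⟩ := Nat.exists_eq_add_of_le hnm
          obtain ⟨h₁, h₂, -⟩ := stable m k (t + o m).toNat (by omega)
          rw [← h₁, hk]
          congr 1
          rw [hk] at ht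
          omega
      rw [key, List.getElem?_eq_getElem hi]
      rfl
    · rw [List.getElem?_eq_none hi, List.getElem?_eq_none (by simpa using hi)]

/-- A window of a bi-infinite word contained in a larger window is an infix of it. -/
lemma map_range_infix {α : Type*} (ω : ℤ → α) {s s' : ℤ} {l l' : ℕ} (h : s' ≤ s)
    (h' : s + l ≤ s' + l') :
    ((List.range l).map fun u : ℕ => ω (s + u)) <:+:
      ((List.range l').map fun u : ℕ => ω (s' + u)) := by
  obtain ⟨d, hd⟩ := Int.le.dest h
  obtain ⟨e, he⟩ : ∃ e, l' = d + l + e := Nat.exists_eq_add_of_le (by omega)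
  refine ⟨(List.range d).map fun u : ℕ => ω (s' + u),
    (List.range e).map fun u : ℕ => ω (s + l + u), ?_⟩
  subst he hd
  simp [List.range_add, Function.comp_def, add_assoc]

lemma mem_bigShift_iff {ω : ℤ → Bool} :
    ω ∈ BigShift ↔ ∀ (s : ℤ) (l : ℕ), ∃ (ξ : ℕ × ℕ → Bool) (v : ℕ × ℕ),
      ((List.range l).map fun u : ℕ => ω (s + u)) <:+: basicBlock ξ v := by
  simp [BigShift, ← List.map_eq_flatMap, Function.comp_def]

/-- An ordering whose block at `(3,3)` is `markerWord`; along the column `x = 3` the new blocks are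
added alternately to the left and to the right. -/
def markerOrdering (v : ℕ × ℕ) : Bool :=
  v.1 + v.2 = 4 ∨ (4 ≤ v.2 ∧ v.2 % 2 = 0)

lemma basicBlock_markerOrdering : basicBlock markerOrdering (3, 3) = markerWord := by
  simp [basicBlock, markerOrdering, markerWord]

lemma basicBlock_ne_nil (ξ : ℕ × ℕ → Bool) (x y : ℕ) : basicBlock ξ (x, y + 1) ≠ [] := by
  induction x with
  | zero => simp [basicBlock_col_zero]
  | succ x ih =>
    rw [basicBlock_succ_succ]
    split <;> simp [ih]

/-- If `ξ` alternates along the column `x = 3` then its block at `(3,3)` occurs in the big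
subshift. -/
lemma exists_mem_bigShift (ξ : ℕ × ℕ → Bool)
    (h : ∀ n, ξ (3, 2 * n + 5) = !ξ (3, 2 * n + 4)) :
    ∃ ω ∈ BigShift, ∃ s : ℤ, basicBlock ξ (3, 3) =
      (List.range (basicBlock ξ (3, 3)).length).map fun u : ℕ => ω (s + u) := by
  have step (n : ℕ) : ∃ L R : List Bool, L ≠ [] ∧ R ≠ [] ∧
      basicBlock ξ (3, 2 * (n + 1) + 3) = L ++ basicBlock ξ (3, 2 * n + 3) ++ R := by
    have e : basicBlock ξ (3, 2 * (n + 1) + 3) = _ := basicBlock_succ_succ ξ 2 (2 * n + 4)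
    have e' : basicBlock ξ (3, 2 * n + 4) = _ := basicBlock_succ_succ ξ 2 (2 * n + 3)
    have hn := h n
    cases hc : ξ (3, 2 * n + 4)
    · refine ⟨basicBlock ξ (2, 2 * n + 5), basicBlock ξ (2, 2 * n + 4),
        basicBlock_ne_nil _ _ _, basicBlock_ne_nil _ _ _, ?_⟩
      rw [e, e']
      simp [hc, hn]
    · refine ⟨basicBlock ξ (2, 2 * n + 4), basicBlock ξ (2, 2 * n + 5),
        basicBlock_ne_nil _ _ _, basicBlock_ne_nil _ _ _, ?_⟩
      rw [e, e']
      simp [hc, hn]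
  choose L R hL hR hV using step
  obtain ⟨ω, o, ho, hω⟩ :=
    exists_biinfinite_limit (fun n => basicBlock ξ (3, 2 * n + 3)) L R hV hL hR
  refine ⟨ω, mem_bigShift_iff.2 fun s l => ?_, -o 0, hω 0⟩
  let n := s.natAbs + l
  have := ho n
  refine ⟨ξ, (3, 2 * n + 3), ?_⟩
  have hn := hω n
  rw [hn]
  apply map_range_infix <;> omega

/-- A dense orbit visits every window of every point. -/
lemma exists_window_eq_of_mem_closure {α : Type*} [TopologicalSpace α] [DiscreteTopology α]
    {ω ω' : ℤ → α}
    (h : ω' ∈ closure {ω'' : ℤ → α | ∃ n : ℤ, ω'' = fun t => ω (t + n)}) (s : ℤ) (l : ℕ) :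
    ∃ s' : ℤ, ((List.range l).map fun u : ℕ => ω (s' + u)) =
      (List.range l).map fun u : ℕ => ω' (s + u) := by
  let U : Set (ℤ → α) := (Finset.Ico s (s + l) : Set ℤ).pi fun t => {ω' t}
  have hU : IsOpen U := isOpen_set_pi (Finset.finite_toSet _) fun _ _ => isOpen_discrete _
  obtain ⟨_, hx, n, rfl⟩ := mem_closure_iff.1 h U hU fun _ _ => rfl
  refine ⟨s + n, List.map_congr_left fun u hu => ?_⟩
  have := hx (s + u) (by simpa using List.mem_range.1 hu)
  simp only [Set.mem_singleton_iff] at this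
  rw [← this]
  congr 1
  ring

theorem stmt15 :
    ¬ ∃ ω ∈ BigShift, ∀ ω' ∈ BigShift,
        ω' ∈ closure {ω'' : ℤ → Bool | ∃ n : ℤ, ω'' = fun t => ω (t + n)} := by
  rintro ⟨ω, hω, dense⟩
  have occurs (ξ : ℕ × ℕ → Bool) (h : ∀ n, ξ (3, 2 * n + 5) = !ξ (3, 2 * n + 4)) :
      ∃ s : ℤ, basicBlock ξ (3, 3) =
        (List.range (basicBlock ξ (3, 3)).length).map fun u : ℕ => ω (s + u) := by
    obtain ⟨ω', hω', s, hs⟩ := exists_mem_bigShift ξ h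
    obtain ⟨s', hs'⟩ := exists_window_eq_of_mem_closure (dense ω' hω') s
      (basicBlock ξ (3, 3)).length
    exact ⟨s', hs.trans hs'.symm⟩
  have alt (n : ℕ) : markerOrdering (3, 2 * n + 5) = !markerOrdering (3, 2 * n + 4) := by
    simp [markerOrdering]
    omega
  obtain ⟨s₀, h₀⟩ := occurs markerOrdering alt
  obtain ⟨s₁, h₁⟩ := occurs (fun v => !markerOrdering v) fun n => by simp [alt n]
  rw [basicBlock_compl] at h₁
  rw [basicBlock_markerOrdering] at h₀ h₁
  obtain ⟨ξ, v, hv⟩ := mem_bigShift_iff.1 hω (min s₀ s₁) ((s₀ - s₁).natAbs + 20)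
  have len : markerWord.length = 20 := rfl
  have i₀ : markerWord <:+: basicBlock ξ v := by
    rw [h₀]
    refine (map_range_infix ω ?_ ?_).trans hv <;> omega
  have i₁ : markerWord.reverse <:+: basicBlock ξ v := by
    rw [h₁, List.length_reverse]
    refine (map_range_infix ω ?_ ?_).trans hv <;> omega
  cases hξ : ξ (1, 1)
  · exact not_reverse_markerWord_infix ξ hξ v i₁
  · exact not_markerWord_infix ξ hξ v i₀
end
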